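/- arXiv:1211.2592 — 4 statements merged into one kernel-verified Lean document; each statement's English description precedes it below -/
import Mathlib

section
/- Let K be an algebraically closed field of characteristic zero and let R be a commutative finitely generated K-algebra equipped with a locally nilpotent K-linear derivation d. Then the differential operator ring S = R[θ; d] satisfies property (⋄), i.e. every finitely generated essential extension of a simple left S-module is Artinian. -/
universe u

/-- Property (⋄): every finitely generated essential extension of a simple left module
is Artinian. -/
def HasDiamond (A : Type*) [Ring A] : Prop :=
  ∀ (M : Type u) [AddCommGroup M] [Module A M], Module.Finite A M →
    ∀ N : Submodule A M, IsSimpleModule A ↥N →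
      (∀ N' : Submodule A M, N ⊓ N' = ⊥ → N' = ⊥) → IsArtinian A M

/-- `S = R[θ; d]` : `S` is free as a left `R`-module with basis `{θ^n}` (equivalently,
the evaluation map from polynomials is bijective) and `θ a = a θ + d(a)`. -/
structure IsDiffOpRing {R S : Type*} [Ring R] [Ring S] (d : R → R) (ι : R →+* S)
    (θ : S) : Prop where
  basis : Function.Bijective fun p : Polynomial R => p.sum fun i a => ι a * θ ^ i
  rel : ∀ a : R, θ * ι a = ι a * θ + ι (d a)

theorem exists_stable_row_of_monotone {α : Type*} [PartialOrder α] [WellFoundedGT α]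
    (L : ℕ → ℕ → α) (h₁ : ∀ k, Monotone fun n => L n k) (h₂ : ∀ n, Monotone (L n)) :
    ∃ N, ∀ n, N ≤ n → ∀ k, L n k = L N k := by
  have stab : ∀ f : ℕ →o α, ∃ n, ∀ m, n ≤ m → f n = f m :=
    fun f => WellFoundedGT.monotone_chain_condition f
  obtain ⟨a, ha⟩ := stab ⟨fun n => L n n, fun i j hij => (h₁ i hij).trans (h₂ j hij)⟩
  choose b hb using fun k => stab ⟨fun n => L n k, h₁ k⟩
  have key : ∀ n k, a ≤ n → a ≤ k → L n k = L a a := fun n k hn hk => by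
    refine le_antisymm ?_ ((h₁ a hn).trans (h₂ n hk))
    have := ha (max n k) (hn.trans (le_max_left _ _))
    exact ((h₁ k (le_max_left n k)).trans (h₂ _ (le_max_right n k))).trans this.ge
  refine ⟨max a ((Finset.range a).sup b), fun n hn k => ?_⟩
  rcases le_or_gt a k with hk | hk
  · rw [key n k ((le_max_left _ _).trans hn) hk, key _ k (le_max_left _ _) hk]
  · have hbk : b k ≤ max a ((Finset.range a).sup b) :=
      (Finset.le_sup (f := b) (Finset.mem_range.2 hk)).trans (le_max_right _ _)
    exact (hb k n (hbk.trans hn)).symm.trans (hb k _ hbk)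

section Orbit

variable {R M : Type*} [CommRing R] [AddCommGroup M] [Module R M]

/-- `D` satisfies the Leibniz rule for the action of `R`, relative to `δ : R → R`. -/
def IsSkewDerivation (δ : R → R) (D : M →+ M) : Prop :=
  ∀ (r : R) (m : M), D (r • m) = r • D m + δ r • m

variable (R) in
/-- The `R`-span of `u, D u, …, D^(n-1) u`. -/
def orbitSpan (D : M →+ M) (u : M) (n : ℕ) : Submodule R M :=
  Submodule.span R ((fun j => (⇑D)^[j] u) '' Set.Iio n)

theorem orbitSpan_zero (D : M →+ M) (u : M) : orbitSpan R D u 0 = ⊥ := by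
  simp [orbitSpan]

theorem orbitSpan_mono (D : M →+ M) (u : M) : Monotone (orbitSpan R D u) :=
  fun _ _ h => Submodule.span_mono (Set.image_mono (Set.Iio_subset_Iio h))

theorem mem_orbitSpan_succ {D : M →+ M} {u m : M} {n : ℕ} :
    m ∈ orbitSpan R D u (n + 1) ↔ ∃ r : R, ∃ f ∈ orbitSpan R D u n, m = r • (⇑D)^[n] u + f := by
  have : Set.Iio (n + 1) = insert n (Set.Iio n) := by
    ext x; simp only [Set.mem_Iio, Set.mem_insert_iff]; lia
  rw [orbitSpan, this, Set.image_insert_eq, Submodule.mem_span_insert]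
  rfl

theorem iterate_mem_orbitSpan (D : M →+ M) (u : M) {j n : ℕ} (h : j < n) :
    (⇑D)^[j] u ∈ orbitSpan R D u n :=
  Submodule.subset_span ⟨j, h, rfl⟩

theorem IsSkewDerivation.map_mem_orbitSpan {δ : R → R} {D : M →+ M} (hD : IsSkewDerivation δ D)
    {u m : M} {n : ℕ} (hm : m ∈ orbitSpan R D u n) : D m ∈ orbitSpan R D u (n + 1) := by
  induction n generalizing m with
  | zero =>
    rw [orbitSpan_zero, Submodule.mem_bot] at hm
    simp [hm]
  | succ n ih =>
    obtain ⟨r, f, hf, rfl⟩ := mem_orbitSpan_succ.1 hm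
    rw [map_add, hD, ← Function.iterate_succ_apply' D]
    exact add_mem (add_mem (Submodule.smul_mem _ _ (iterate_mem_orbitSpan D u (by lia)))
      (Submodule.smul_mem _ _ (iterate_mem_orbitSpan D u (by lia))))
      (orbitSpan_mono D u (by lia) (ih hf))

theorem mem_iSup_orbitSpan {D : M →+ M} {u m : M} :
    m ∈ ⨆ n, orbitSpan R D u n ↔ ∃ n, m ∈ orbitSpan R D u n :=
  Submodule.mem_iSup_of_directed _ (orbitSpan_mono D u).directed_le

theorem self_mem_iSup_orbitSpan (D : M →+ M) (u : M) : u ∈ ⨆ n, orbitSpan R D u n :=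
  mem_iSup_orbitSpan.2 ⟨1, iterate_mem_orbitSpan D u one_pos⟩

theorem IsSkewDerivation.map_mem_iSup_orbitSpan {δ : R → R} {D : M →+ M}
    (hD : IsSkewDerivation δ D) {u m : M} (hm : m ∈ ⨆ n, orbitSpan R D u n) :
    D m ∈ ⨆ n, orbitSpan R D u n := by
  obtain ⟨n, hn⟩ := mem_iSup_orbitSpan.1 hm
  exact mem_iSup_orbitSpan.2 ⟨n + 1, hD.map_mem_orbitSpan hn⟩

/-- The ideal of leading coefficients, in degree `k`, of the elements of `P` written in terms of
the orbit of `u`. -/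
def leadingIdeal (D : M →+ M) (u : M) (P : Submodule R M) (k : ℕ) : Ideal R :=
  (orbitSpan R D u k ⊔ P).comap (LinearMap.toSpanSingleton R M ((⇑D)^[k] u))

theorem mem_leadingIdeal {D : M →+ M} {u : M} {P : Submodule R M} {k : ℕ} {r : R} :
    r ∈ leadingIdeal D u P k ↔ r • (⇑D)^[k] u ∈ orbitSpan R D u k ⊔ P := Iff.rfl

theorem IsSkewDerivation.leadingIdeal_mono {δ : R → R} {D : M →+ M} (hD : IsSkewDerivation δ D)
    (u : M) {P : Submodule R M} (hP : ∀ m ∈ P, D m ∈ P) : Monotone (leadingIdeal D u P) := by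
  refine monotone_nat_of_le_succ fun k r hr => ?_
  rw [mem_leadingIdeal] at hr ⊢
  obtain ⟨f, hf, p, hp, h⟩ := Submodule.mem_sup.1 hr
  have e : r • (⇑D)^[k + 1] u = D f - δ r • (⇑D)^[k] u + D p := by
    rw [Function.iterate_succ_apply', eq_comm, sub_add_eq_add_sub, sub_eq_iff_eq_add, ← hD, ← h,
      map_add]
  rw [e]
  exact Submodule.add_mem_sup (sub_mem (hD.map_mem_orbitSpan hf)
    (Submodule.smul_mem _ _ (iterate_mem_orbitSpan D u k.lt_succ_self))) (hP p hp)

theorem inf_orbitSpan_le_of_leadingIdeal_le {D : M →+ M} {u : M} {P Q : Submodule R M}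
    (hPQ : P ≤ Q) (h : ∀ k, leadingIdeal D u Q k ≤ leadingIdeal D u P k) (n : ℕ) :
    ∀ m ∈ Q, m ∈ orbitSpan R D u n → m ∈ P := by
  induction n with
  | zero =>
    intro m _ hm
    rw [orbitSpan_zero, Submodule.mem_bot] at hm
    simp [hm]
  | succ n ih =>
    intro m hmQ hm
    obtain ⟨r, f, hf, rfl⟩ := mem_orbitSpan_succ.1 hm
    have hr : r ∈ leadingIdeal D u Q n := by
      rw [mem_leadingIdeal]
      exact Submodule.mem_sup.2 ⟨-f, neg_mem hf, _, hmQ, by abel⟩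
    obtain ⟨g, hg, p, hp, e⟩ := Submodule.mem_sup.1 (mem_leadingIdeal.1 (h n hr))
    have key := ih (g + f) (by
      have : g + f = (r • (⇑D)^[n] u + f) - p := by rw [← e]; abel
      rw [this]; exact sub_mem hmQ (hPQ hp)) (add_mem hg hf)
    rw [← e, show g + p + f = (g + f) + p by abel]
    exact add_mem key hp

theorem leadingIdeal_le_of_le (D : M →+ M) (u : M) {P Q : Submodule R M} (h : P ≤ Q) (k : ℕ) :
    leadingIdeal D u P k ≤ leadingIdeal D u Q k :=
  Submodule.comap_mono (sup_le_sup_left h _)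

theorem IsSkewDerivation.exists_stable_of_monotone [IsNoetherianRing R] {δ : R → R} {D : M →+ M}
    (hD : IsSkewDerivation δ D) {u : M} (hu : ∀ m, ∃ n, m ∈ orbitSpan R D u n)
    (P : ℕ → Submodule R M) (hP : Monotone P) (hPD : ∀ n, ∀ m ∈ P n, D m ∈ P n) :
    ∃ N, ∀ n, N ≤ n → P n = P N := by
  obtain ⟨N, hN⟩ := exists_stable_row_of_monotone (fun n => leadingIdeal D u (P n))
    (fun k i j hij => leadingIdeal_le_of_le D u (hP hij) k)
    (fun n => hD.leadingIdeal_mono u (hPD n))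
  refine ⟨N, fun n hn => le_antisymm (fun m hm => ?_) (hP hn)⟩
  obtain ⟨k, hk⟩ := hu m
  exact inf_orbitSpan_le_of_leadingIdeal_le (hP hn) (fun k => (hN n hn k).le) k m hm hk

end Orbit

section Generated

open Polynomial

variable {R S M : Type*} [CommRing R] [Ring S] [AddCommGroup M] [Module S M]
  {ι : R →+* S} {θ : S}

theorem smul_mem_of_generators (hgen : ∀ s, ∃ p : R[X], (p.sum fun i a => ι a * θ ^ i) = s)
    (W : AddSubmonoid M) (hR : ∀ r, ∀ m ∈ W, ι r • m ∈ W) (hθ : ∀ m ∈ W, θ • m ∈ W)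
    (s : S) {m : M} (hm : m ∈ W) : s • m ∈ W := by
  obtain ⟨p, rfl⟩ := hgen s
  rw [Polynomial.sum_def, Finset.sum_smul]
  refine sum_mem fun i hi => ?_
  clear hi
  rw [mul_smul]
  refine hR _ _ ?_
  induction i with
  | zero => simpa using hm
  | succ i ih =>
    rw [pow_succ', mul_smul]
    exact hθ _ ih

theorem smul_comm_of_generators (hgen : ∀ s, ∃ p : R[X], (p.sum fun i a => ι a * θ ^ i) = s)
    (f : M →+ M) (hR : ∀ r m, f (ι r • m) = ι r • f m) (hθ : ∀ m, f (θ • m) = θ • f m)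
    (s : S) (m : M) : f (s • m) = s • f m := by
  obtain ⟨p, rfl⟩ := hgen s
  rw [Polynomial.sum_def, Finset.sum_smul, Finset.sum_smul, map_sum]
  refine Finset.sum_congr rfl fun i hi => ?_
  clear hi
  rw [mul_smul, mul_smul, hR]
  congr 1
  induction i with
  | zero => simp
  | succ i ih => rw [pow_succ', mul_smul, mul_smul, hθ, ih]

/-- An additive endomorphism commuting with generators of `S` is `S`-linear. -/
def endOfGenerators (hgen : ∀ s, ∃ p : R[X], (p.sum fun i a => ι a * θ ^ i) = s)
    (f : M →+ M) (hR : ∀ r m, f (ι r • m) = ι r • f m) (hθ : ∀ m, f (θ • m) = θ • f m) :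
    Module.End S M :=
  { f with map_smul' := smul_comm_of_generators hgen f hR hθ }

/-- Multiplication by `c` on a module on which the derivative of `c` acts as zero. -/
def mulEnd (hgen : ∀ s, ∃ p : R[X], (p.sum fun i a => ι a * θ ^ i) = s) {δ : R → R}
    (rel : ∀ a : R, θ * ι a = ι a * θ + ι (δ a)) (c : R) (hc : ∀ m : M, ι (δ c) • m = 0) :
    Module.End S M :=
  endOfGenerators hgen (DistribSMul.toAddMonoidHom M (ι c))
    (fun r m => by simp only [DistribSMul.toAddMonoidHom_apply, ← mul_smul, ← map_mul, mul_comm])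
    (fun m => by
      simp only [DistribSMul.toAddMonoidHom_apply, ← mul_smul, rel, add_smul, hc, add_zero])

theorem isSkewDerivation_smul [Module R M] (hι : ∀ (r : R) (m : M), r • m = ι r • m) {δ : R → R}
    (rel : ∀ a : R, θ * ι a = ι a * θ + ι (δ a)) :
    IsSkewDerivation δ (DistribSMul.toAddMonoidHom M θ) := fun r m => by
  simp only [DistribSMul.toAddMonoidHom_apply, hι, ← mul_smul, rel, add_smul]

theorem smul_mem_iSup_orbitSpan [Module R M] (hι : ∀ (r : R) (m : M), r • m = ι r • m)
    (hgen : ∀ s, ∃ p : R[X], (p.sum fun i a => ι a * θ ^ i) = s) {δ : R → R}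
    (rel : ∀ a : R, θ * ι a = ι a * θ + ι (δ a)) (u : M) (s : S) :
    s • u ∈ ⨆ n, orbitSpan R (DistribSMul.toAddMonoidHom M θ) u n :=
  smul_mem_of_generators hgen
    (⨆ n, orbitSpan R (DistribSMul.toAddMonoidHom M θ) u n).toAddSubmonoid
    (fun r m hm => by rw [← hι]; exact Submodule.smul_mem _ r hm)
    (fun _ hm => (isSkewDerivation_smul hι rel).map_mem_iSup_orbitSpan hm) s
    (self_mem_iSup_orbitSpan _ u)

theorem isNoetherianRing_of_generators [IsNoetherianRing R]
    (hgen : ∀ s, ∃ p : R[X], (p.sum fun i a => ι a * θ ^ i) = s) {δ : R → R}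
    (rel : ∀ a : R, θ * ι a = ι a * θ + ι (δ a)) : IsNoetherianRing S := by
  let _ : Module R S := Module.compHom S ι
  have hι : ∀ (r : R) (s : S), r • s = ι r • s := fun _ _ => rfl
  refine monotone_stabilizes_iff_noetherian.1 fun f => ?_
  obtain ⟨N, hN⟩ := (isSkewDerivation_smul hι rel).exists_stable_of_monotone (u := (1 : S))
    (fun m => mem_iSup_orbitSpan.1 (by simpa using smul_mem_iSup_orbitSpan hι hgen rel (1 : S) m))
    (fun n => { f n with smul_mem' := fun r x hx => (f n).smul_mem (ι r) hx })
    (fun i j hij => f.monotone hij) (fun n m hm => (f n).smul_mem θ hm)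
  refine ⟨N, fun n hn => (SetLike.ext fun x => ?_)⟩
  exact (SetLike.ext_iff.1 (hN n hn) x).symm

end Generated

section Schur

open Polynomial

/-- Over an algebraically closed field, an operator without eigenvectors in an invariant subspace
has only injective nonzero polynomials there. -/
theorem eq_zero_of_aeval_apply_eq_zero {K M : Type*} [Field K] [IsAlgClosed K] [AddCommGroup M]
    [Module K M] (D : Module.End K M) (T : Submodule K M) (hT : ∀ w ∈ T, D w ∈ T)
    (h : ∀ μ : K, ∀ w ∈ T, D w = μ • w → w = 0) {g : K[X]} (hg : g ≠ 0) {w : M} (hw : w ∈ T)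
    (hgw : aeval D g w = 0) : w = 0 := by
  induction hn : g.natDegree generalizing g with
  | zero =>
    obtain ⟨a, rfl⟩ := natDegree_eq_zero.1 hn
    rw [aeval_C, Module.algebraMap_end_apply] at hgw
    exact (smul_eq_zero.1 hgw).resolve_left fun ha => hg (by rw [ha, C_0])
  | succ n ih =>
    obtain ⟨μ, hμ⟩ := IsAlgClosed.exists_root g
      (fun h0 => by rw [natDegree_eq_zero_iff_degree_le_zero.2 h0.le] at hn; lia)
    obtain ⟨q, rfl⟩ := dvd_iff_isRoot.2 hμ
    have hq : q ≠ 0 := right_ne_zero_of_mul hg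
    have hqT : aeval D q w ∈ T := by
      rw [aeval_endomorphism]
      exact sum_mem fun i _ => T.smul_mem _ (Module.End.pow_apply_mem_of_forall_mem _ hT _ hw)
    refine ih hq (h μ _ hqT ?_) ?_
    · rw [map_mul, Module.End.mul_apply, map_sub, aeval_X, aeval_C, LinearMap.sub_apply,
        Module.algebraMap_end_apply, sub_eq_zero] at hgw
      exact hgw
    · rw [natDegree_mul (X_sub_C_ne_zero μ) hq, natDegree_X_sub_C] at hn
      lia

theorem exists_aeval_mul_mem_of_torsion {K R : Type*} [Field K] [CommRing R] [Algebra K R]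
    [IsNoetherianRing R] (L : Ideal R) (c : R) :
    ∃ g : K[X], g ≠ 0 ∧ ∀ f : K[X], f ≠ 0 → ∀ r, aeval c f * r ∈ L → aeval c g * r ∈ L := by
  let A : K[X] → Ideal R := fun g => Submodule.comap (LinearMap.mulLeft R (aeval c g)) L
  obtain ⟨_, ⟨g, hg, rfl⟩, hmax⟩ := set_has_maximal_iff_noetherian.2 ‹IsNoetherianRing R›
    (A '' {g | g ≠ 0}) ⟨_, 1, one_ne_zero, rfl⟩
  refine ⟨g, hg, fun f hf r hr => ?_⟩
  have hle : A g ≤ A (g * f) := fun x hx => by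
    simp only [A, Submodule.mem_comap, LinearMap.mulLeft_apply, map_mul] at hx ⊢
    rw [mul_right_comm]
    exact L.mul_mem_right _ hx
  have heq := eq_of_le_of_not_lt hle (hmax _ ⟨g * f, mul_ne_zero hg hf, rfl⟩)
  have : r ∈ A (g * f) := by
    simp only [A, Submodule.mem_comap, LinearMap.mulLeft_apply, map_mul]
    rw [mul_assoc]
    exact L.mul_mem_left _ hr
  rw [← heq] at this
  exact this

theorem mem_of_sub_mul_mem {K R : Type*} [Field K] [CommRing R] [Algebra K R] {L : Ideal R}
    {c r : R} {g : K[X]} {μ : K} (hμ : g.eval μ ≠ 0) (hg : aeval c g * r ∈ L)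
    (hr : (c - algebraMap K R μ) * r ∈ L) : r ∈ L := by
  obtain ⟨q, hq⟩ := X_sub_C_dvd_sub_C_eval (p := g) (a := μ)
  have e : algebraMap K R (g.eval μ) * r =
      aeval c g * r - aeval c q * ((c - algebraMap K R μ) * r) := by
    have := congrArg (aeval c) hq
    simp only [map_sub, map_mul, aeval_X, aeval_C] at this
    linear_combination r * -this
  have h := L.mul_mem_left (algebraMap K R (g.eval μ)⁻¹)
    (e ▸ sub_mem hg (L.mul_mem_left (aeval c q) hr) : algebraMap K R (g.eval μ) * r ∈ L)
  rwa [← mul_assoc, ← map_mul, inv_mul_cancel₀ hμ, map_one, one_mul] at h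

theorem exists_polynomial_forall_mem_of_sub_mul_mem {K R : Type*} [Field K] [CommRing R]
    [Algebra K R] [IsNoetherianRing R] {L : ℕ → Ideal R} (hL : Monotone L) (c : R) :
    ∃ g : K[X], g ≠ 0 ∧ ∀ μ, g.eval μ ≠ 0 →
      ∀ k r, (c - algebraMap K R μ) * r ∈ L k → r ∈ L k := by
  obtain ⟨s, hs⟩ := monotone_stabilizes_iff_noetherian.2 ‹IsNoetherianRing R› ⟨L, hL⟩
  choose g hg0 hg using fun k => exists_aeval_mul_mem_of_torsion (K := K) (L k) c
  refine ⟨∏ k ∈ Finset.range (s + 1), g k, Finset.prod_ne_zero_iff.2 fun k _ => hg0 k,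
    fun μ hμ k r hr => ?_⟩
  rw [eval_prod, Finset.prod_ne_zero_iff] at hμ
  have aux : ∀ k ≤ s, ∀ r, (c - algebraMap K R μ) * r ∈ L k → r ∈ L k := fun k hk r hr =>
    mem_of_sub_mul_mem (hμ k (Finset.mem_range.2 (by lia)))
      (hg k (X - C μ) (X_sub_C_ne_zero μ) r (by simpa using hr)) hr
  rcases le_total k s with hk | hk
  · exact aux k hk r hr
  · have e : L s = L k := hs k hk
    rw [← e] at hr ⊢
    exact aux s le_rfl r hr

theorem mem_orbitSpan_one_of_smul_mem {R M : Type*} [CommRing R] [AddCommGroup M] [Module R M]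
    {D : M →+ M} {u : M} {a : R}
    (ha : ∀ k r, a * r ∈ leadingIdeal D u (⊥ : Submodule R M) k →
      r ∈ leadingIdeal D u (⊥ : Submodule R M) k) (k : ℕ) :
    ∀ w ∈ orbitSpan R D u (k + 1), a • w ∈ orbitSpan R D u 1 → w ∈ orbitSpan R D u 1 := by
  induction k with
  | zero => exact fun w hw _ => hw
  | succ k ih =>
    intro w hw hcw
    obtain ⟨r, f, hf, rfl⟩ := mem_orbitSpan_succ.1 hw
    refine ih _ (add_mem ?_ hf) hcw
    have : r ∈ leadingIdeal D u ⊥ (k + 1) := ha _ _ (by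
      rw [mem_leadingIdeal, sup_bot_eq, mul_smul]
      have h := sub_mem (orbitSpan_mono D u (show 1 ≤ k + 1 by lia) hcw)
        (Submodule.smul_mem _ a hf)
      rwa [smul_add, add_sub_cancel_right] at h)
    rwa [mem_leadingIdeal, sup_bot_eq] at this

/-- A weak Nullstellensatz: if no power of `g(c)` lies in `L`, there is a closed point of `V(L)`
at which `c` takes a value `μ` with `g(μ) ≠ 0`. -/
theorem exists_maximal_sub_algebraMap_mem {K R : Type*} [Field K] [IsAlgClosed K] [CommRing R]
    [Algebra K R] [Algebra.FiniteType K R] {L : Ideal R} {c : R} {g : K[X]}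
    (h : ∀ n, aeval c g ^ n ∉ L) :
    ∃ (m : Ideal R) (μ : K), m.IsMaximal ∧ L ≤ m ∧ c - algebraMap K R μ ∈ m ∧ g.eval μ ≠ 0 := by
  have hJ : IsJacobsonRing R := isJacobsonRing_of_finiteType (A := K)
  have hnot : aeval c g ∉ L.jacobson := by
    rw [← Ideal.radical_eq_jacobson]
    exact fun ⟨n, hn⟩ => h n hn
  obtain ⟨m, ⟨hLm, hm⟩, hgm⟩ : ∃ m ∈ {J : Ideal R | L ≤ J ∧ J.IsMaximal}, aeval c g ∉ m := by
    rw [Ideal.jacobson, Submodule.mem_sInf] at hnot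
    push Not at hnot
    exact hnot
  let _ : Field (R ⧸ m) := Ideal.Quotient.field m
  have : Module.Finite K (R ⧸ m) := finite_of_finite_type_of_isJacobsonRing K (R ⧸ m)
  obtain ⟨μ, hμ⟩ := (IsAlgClosed.algebraMap_bijective_of_isIntegral (k := K) (K := R ⧸ m)).2
    (Ideal.Quotient.mk m c)
  have hcμ : c - algebraMap K R μ ∈ m := by
    rw [← Ideal.Quotient.eq, ← hμ]; rfl
  refine ⟨m, μ, hm, hLm, hcμ, fun h0 => hgm ?_⟩
  obtain ⟨q, hq⟩ := dvd_iff_isRoot.2 h0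
  rw [hq, map_mul, map_sub, aeval_X, aeval_C]
  exact m.mul_mem_right _ hcμ

variable {K R S V : Type*} [Field K] [IsAlgClosed K] [CommRing R] [Algebra K R]
  [Algebra.FiniteType K R] [Ring S] [AddCommGroup V] [Module S V] {ι : R →+* S} {θ : S}

/-- Schur's lemma in the form of Quillen: an element of `R` acting on a simple module by
endomorphisms acts by a scalar. -/
theorem exists_sub_algebraMap_smul_eq_zero [IsSimpleModule S V]
    (hgen : ∀ s, ∃ p : R[X], (p.sum fun i a => ι a * θ ^ i) = s) (d : Derivation K R R)
    (rel : ∀ a : R, θ * ι a = ι a * θ + ι (d a)) (c : R) (hc : ∀ v : V, ι (d c) • v = 0) :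
    ∃ μ : K, ∀ v : V, ι (c - algebraMap K R μ) • v = 0 := by
  by_contra! H
  have : IsNoetherianRing R := Algebra.FiniteType.isNoetherianRing K R
  let _ : Module R V := Module.compHom V ι
  let _ : Module K V := Module.compHom V (algebraMap K R)
  have : IsScalarTower K R V := .of_algebraMap_smul fun _ _ => rfl
  have hι : ∀ (r : R) (v : V), r • v = ι r • v := fun _ _ => rfl
  have bij : ∀ μ : K, Function.Bijective fun v : V => (c - algebraMap K R μ) • v := fun μ => by
    have hc' : ∀ v : V, ι (d (c - algebraMap K R μ)) • v = 0 := fun v => by simp [hc]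
    refine (LinearMap.bijective_or_eq_zero (mulEnd hgen rel _ hc')).resolve_right fun h0 => ?_
    obtain ⟨v, hv⟩ := H μ
    exact hv (LinearMap.congr_fun h0 v)
  have inj : ∀ g : K[X], g ≠ 0 → ∀ v : V, aeval c g • v = 0 → v = 0 := fun g hg v hv => by
    refine eq_zero_of_aeval_apply_eq_zero (Algebra.lsmul K K V c) ⊤ (fun _ _ => trivial)
      (fun μ w _ hw => (bij μ).1 ?_) hg trivial (w := v) ?_
    · simpa [sub_smul, sub_eq_zero] using hw
    · rw [aeval_algHom_apply]
      exact hv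
  have : Nontrivial V := IsSimpleModule.nontrivial S V
  obtain ⟨u, hu⟩ := exists_ne (0 : V)
  have hD : IsSkewDerivation (⇑d) (DistribSMul.toAddMonoidHom V θ) := isSkewDerivation_smul hι rel
  obtain ⟨g, hg0, hg⟩ := exists_polynomial_forall_mem_of_sub_mul_mem (K := K)
    (hD.leadingIdeal_mono u (P := ⊥) (by simp)) c
  have hL0 : ∀ r, r ∈ leadingIdeal (DistribSMul.toAddMonoidHom V θ) u (⊥ : Submodule R V) 0 ↔
      r • u = 0 := fun r => by
    rw [mem_leadingIdeal, orbitSpan_zero, sup_bot_eq, Submodule.mem_bot,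
      Function.iterate_zero_apply]
  obtain ⟨m, μ, hm, hLm, hcm, hμ⟩ := exists_maximal_sub_algebraMap_mem (c := c) (g := g)
    (fun n hn => hu (inj _ (pow_ne_zero n hg0) u (by rw [map_pow]; exact (hL0 _).1 hn)))
  obtain ⟨w, hw⟩ := (bij μ).2 u
  have hw' : (c - algebraMap K R μ) • w = u := hw
  obtain ⟨t, ht⟩ := IsSimpleModule.toSpanSingleton_surjective S hu w
  obtain ⟨k, hk⟩ := mem_iSup_orbitSpan.1 (smul_mem_iSup_orbitSpan hι hgen rel u t)
  rw [← LinearMap.toSpanSingleton_apply S V, ht] at hk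
  have hw1 := mem_orbitSpan_one_of_smul_mem (hg μ hμ) k w (orbitSpan_mono _ u k.le_succ hk)
    (hw'.symm ▸ iterate_mem_orbitSpan _ u one_pos)
  obtain ⟨r, f, hf, e⟩ := mem_orbitSpan_succ.1 hw1
  rw [orbitSpan_zero, Submodule.mem_bot] at hf
  rw [hf, add_zero, Function.iterate_zero_apply] at e
  have hmem := hLm ((hL0 ((c - algebraMap K R μ) * r - 1)).2 (by
    rw [sub_smul, one_smul, mul_smul, ← e, hw', sub_self]))
  refine hm.ne_top ((Ideal.eq_top_iff_one m).2 ?_)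
  have := sub_mem (m.mul_mem_right r hcm) hmem
  rwa [sub_sub_cancel] at this

end Schur

theorem isArtinian_of_isArtinian_ker {S M : Type*} [Ring S] [AddCommGroup M] [Module S M]
    [IsNoetherian S M] {N : Submodule S M} (hN0 : N ≠ ⊥) (hN : ∀ P : Submodule S M, P ≠ ⊥ → N ≤ P)
    (φ : Module.End S M) (hφ : ∀ m ∈ N, φ m = 0) [IsArtinian S (LinearMap.ker φ)] :
    IsArtinian S M := by
  obtain ⟨n, hn⟩ := Filter.eventually_atTop.1 φ.eventually_disjoint_ker_pow_range_pow
  have hker : N ≤ LinearMap.ker (φ ^ (n + 1)) := fun m hm => by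
    rw [LinearMap.mem_ker, pow_succ, Module.End.mul_apply, hφ m hm, map_zero]
  have hr : LinearMap.range (φ ^ (n + 1)) = ⊥ := by
    by_contra h
    exact hN0 ((hn (n + 1) n.le_succ).mono hker (hN _ h) |>.eq_bot_of_self)
  have hk : ∀ k, IsArtinian S (LinearMap.ker (φ ^ k)) := by
    intro k
    induction k with
    | zero =>
      have : LinearMap.ker (φ ^ 0) = ⊥ := by rw [pow_zero]; exact LinearMap.ker_id
      rw [this]; infer_instance
    | succ k ih =>
      let f : LinearMap.ker φ →ₗ[S] LinearMap.ker (φ ^ (k + 1)) :=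
        Submodule.inclusion fun m hm => by
          rw [LinearMap.mem_ker, pow_succ, Module.End.mul_apply, LinearMap.mem_ker.1 hm, map_zero]
      let g : LinearMap.ker (φ ^ (k + 1)) →ₗ[S] LinearMap.ker (φ ^ k) :=
        φ.restrict fun m hm => by
          rw [LinearMap.mem_ker, pow_succ, Module.End.mul_apply] at hm
          exact hm
      refine isArtinian_of_range_eq_ker f g ?_
      ext ⟨m, hm⟩
      rw [Submodule.range_inclusion, Submodule.mem_comap, LinearMap.mem_ker, LinearMap.mem_ker,
        Subtype.ext_iff]
      rfl
  have := hk (n + 1)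
  rw [LinearMap.range_eq_bot.1 hr, LinearMap.ker_zero] at this
  exact isArtinian_of_linearEquiv Submodule.topEquiv

section Torsion

variable {A M : Type*} [CommRing A] [IsDomain A] [AddCommGroup M] [Module A M]
  {δ : A → A} {D : M →+ M}

/-- The elements of `M` having a nonzero multiple in `Q`. -/
def torsionClosure (Q : Submodule A M) : Submodule A M :=
  (Submodule.torsion A (M ⧸ Q)).comap Q.mkQ

theorem mem_torsionClosure {Q : Submodule A M} {m : M} :
    m ∈ torsionClosure Q ↔ ∃ a : A, a ≠ 0 ∧ a • m ∈ Q := by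
  rw [torsionClosure, Submodule.mem_comap, Submodule.mem_torsion_iff]
  simp only [Submodule.mkQ_apply, Subtype.exists, mem_nonZeroDivisors_iff_ne_zero,
    Submonoid.mk_smul, ← Submodule.Quotient.mk_smul, Submodule.Quotient.mk_eq_zero, exists_prop]

theorem le_torsionClosure (Q : Submodule A M) : Q ≤ torsionClosure Q := fun m hm =>
  mem_torsionClosure.2 ⟨1, one_ne_zero, by rwa [one_smul]⟩

theorem mem_torsionClosure_of_smul_mem {Q : Submodule A M} {a : A} (ha : a ≠ 0) {m : M}
    (h : a • m ∈ torsionClosure Q) : m ∈ torsionClosure Q := by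
  obtain ⟨b, hb, hbm⟩ := mem_torsionClosure.1 h
  exact mem_torsionClosure.2 ⟨b * a, mul_ne_zero hb ha, by rwa [mul_smul]⟩

theorem IsSkewDerivation.map_mem_torsionClosure (hD : IsSkewDerivation δ D) {Q : Submodule A M}
    (hQ : ∀ m ∈ Q, D m ∈ torsionClosure Q) {m : M} (hm : m ∈ torsionClosure Q) :
    D m ∈ torsionClosure Q := by
  obtain ⟨a, ha, ham⟩ := mem_torsionClosure.1 hm
  refine mem_torsionClosure_of_smul_mem ha ?_
  rw [← add_sub_cancel_right (a • D m) (δ a • m), ← hD]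
  exact sub_mem (hQ _ ham) (Submodule.smul_mem _ _ hm)

theorem torsionClosure_mono : Monotone (torsionClosure : Submodule A M → Submodule A M) :=
  fun _ _ h _ hm =>
    let ⟨a, ha, ham⟩ := mem_torsionClosure.1 hm
    mem_torsionClosure.2 ⟨a, ha, h ham⟩

theorem isTorsion_quotient_submoduleOf_iff {P Q : Submodule A M} :
    Module.IsTorsion A (Q ⧸ P.submoduleOf Q) ↔ Q ≤ torsionClosure P := by
  refine ⟨fun h m hm => ?_, fun h x => ?_⟩
  · obtain ⟨a, ha⟩ := @h (Submodule.Quotient.mk ⟨m, hm⟩)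
    refine mem_torsionClosure.2 ⟨a, nonZeroDivisors.ne_zero a.2, ?_⟩
    rwa [Submonoid.smul_def, ← Submodule.Quotient.mk_smul, Submodule.Quotient.mk_eq_zero] at ha
  · obtain ⟨⟨m, hm⟩, rfl⟩ := Submodule.Quotient.mk_surjective _ x
    obtain ⟨a, ha, ham⟩ := mem_torsionClosure.1 (h hm)
    refine ⟨⟨a, mem_nonZeroDivisors_of_ne_zero ha⟩, ?_⟩
    rwa [Submonoid.mk_smul, ← Submodule.Quotient.mk_smul, Submodule.Quotient.mk_eq_zero]

theorem rank_quotient_submoduleOf_add_rank {P Q : Submodule A M} (h : P ≤ Q) :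
    Module.rank A (Q ⧸ P.submoduleOf Q) + Module.rank A P = Module.rank A Q := by
  rw [← (Submodule.submoduleOfEquivOfLe h).rank_eq]
  exact rank_quotient_add_rank_of_isDomain _

theorem rank_le_of_le_torsionClosure {P Q : Submodule A M} (h : P ≤ torsionClosure Q) :
    Module.rank A P ≤ Module.rank A Q := by
  refine (Submodule.rank_mono h).trans ?_
  rw [← rank_quotient_submoduleOf_add_rank (le_torsionClosure Q),
    (isTorsion_quotient_submoduleOf_iff.2 le_rfl).rank_eq_zero, zero_add]

theorem le_torsionClosure_of_finrank_le {P Q : Submodule A M}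
    (hfin : Module.rank A M < Cardinal.aleph0) (hPQ : P ≤ Q)
    (h : Module.finrank A Q ≤ Module.finrank A P) : Q ≤ torsionClosure P := by
  rw [← isTorsion_quotient_submoduleOf_iff, ← Module.rank_eq_zero_iff_isTorsion]
  have hlt : ∀ P : Submodule A M, Module.rank A P < Cardinal.aleph0 :=
    fun P => (Submodule.rank_le P).trans_lt hfin
  have e := rank_quotient_submoduleOf_add_rank hPQ
  have hq : Module.rank A (Q ⧸ P.submoduleOf Q) < Cardinal.aleph0 :=
    (self_le_add_right _ _).trans_lt (e.trans_lt (hlt Q))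
  have e' := congrArg Cardinal.toNat e
  rw [Cardinal.toNat_add hq (hlt P)] at e'
  refine ((Cardinal.toNat_eq_zero).1 ?_).resolve_right hq.not_ge
  change _ + Module.finrank A P = Module.finrank A Q at e'
  lia

theorem IsSkewDerivation.orbitSpan_le_torsionClosure (hD : IsSkewDerivation δ D) {u : M} {n : ℕ}
    (h : (⇑D)^[n] u ∈ torsionClosure (orbitSpan A D u n)) (k : ℕ) :
    orbitSpan A D u k ≤ torsionClosure (orbitSpan A D u n) := by
  have hQ : ∀ m ∈ orbitSpan A D u n, D m ∈ torsionClosure (orbitSpan A D u n) := fun m hm => by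
    obtain ⟨r, f, hf, e⟩ := mem_orbitSpan_succ.1 (hD.map_mem_orbitSpan hm)
    rw [e]
    exact add_mem (Submodule.smul_mem _ _ h) (le_torsionClosure _ hf)
  refine Submodule.span_le.2 ?_
  rintro _ ⟨j, -, rfl⟩
  dsimp only
  induction j with
  | zero =>
    rcases n.eq_zero_or_pos with rfl | hn
    · exact h
    · exact le_torsionClosure _ (iterate_mem_orbitSpan D u hn)
  | succ j ih =>
    rw [Function.iterate_succ_apply']
    exact hD.map_mem_torsionClosure hQ ih

theorem IsSkewDerivation.exists_iterate_mem_torsionClosure (hD : IsSkewDerivation δ D) {u v : M}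
    (hv0 : v ≠ 0) (hv : v ∈ ⨆ n, orbitSpan A D u n)
    (hDv : D v = 0 ∨ v ∈ ⨆ n, orbitSpan A D (D v) n) :
    ∃ n, (⇑D)^[n] u ∈ torsionClosure (orbitSpan A D u n) := by
  by_contra! H
  have indep : ∀ n (a : A), a • (⇑D)^[n] u ∈ orbitSpan A D u n → a = 0 := fun n a ha => by
    by_contra h0
    exact H n (mem_torsionClosure.2 ⟨a, h0, ha⟩)
  -- every nonzero element has a leading term
  have lead : ∀ w : M, w ≠ 0 → ∀ n, w ∈ orbitSpan A D u n →
      ∃ r, ∃ a : A, a ≠ 0 ∧ w - a • (⇑D)^[r] u ∈ orbitSpan A D u r := by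
    intro w hw n
    induction n with
    | zero => exact fun h => (hw (by rwa [orbitSpan_zero, Submodule.mem_bot] at h)).elim
    | succ n ih =>
      intro h
      obtain ⟨a, f, hf, rfl⟩ := mem_orbitSpan_succ.1 h
      by_cases ha : a = 0
      · exact ih (by simpa [ha] using hf)
      · exact ⟨n, a, ha, by rwa [add_sub_cancel_left]⟩
  have lead_map : ∀ w r (a : A), w - a • (⇑D)^[r] u ∈ orbitSpan A D u r →
      D w - a • (⇑D)^[r + 1] u ∈ orbitSpan A D u (r + 1) := by
    intro w r a h
    have e : D w - a • (⇑D)^[r + 1] u = D (w - a • (⇑D)^[r] u) + δ a • (⇑D)^[r] u := by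
      rw [map_sub, hD, Function.iterate_succ_apply']; abel
    rw [e]
    exact add_mem (hD.map_mem_orbitSpan h)
      (Submodule.smul_mem _ _ (iterate_mem_orbitSpan D u r.lt_succ_self))
  obtain ⟨n, hn⟩ := mem_iSup_orbitSpan.1 hv
  obtain ⟨r, a, ha, hvr⟩ := lead v hv0 n hn
  have lead_iter : ∀ j, (⇑D)^[j] (D v) - a • (⇑D)^[r + 1 + j] u ∈ orbitSpan A D u (r + 1 + j) := by
    intro j
    induction j with
    | zero => exact lead_map _ _ _ hvr
    | succ j ih =>
      rw [Function.iterate_succ_apply']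
      exact lead_map _ _ _ ih
  have hvr' : v ∈ orbitSpan A D u (r + 1) :=
    mem_orbitSpan_succ.2 ⟨a, _, hvr, by abel⟩
  -- a combination of the orbit of `D v` lying in degree at most `r` vanishes
  have small : ∀ s, ∀ w ∈ orbitSpan A D (D v) s, w ∈ orbitSpan A D u (r + 1) → w = 0 := by
    intro s
    induction s with
    | zero => exact fun w hw _ => by rwa [orbitSpan_zero, Submodule.mem_bot] at hw
    | succ s ih =>
      intro w hw hwr
      obtain ⟨b, f, hf, rfl⟩ := mem_orbitSpan_succ.1 hw
      have hle : orbitSpan A D (D v) s ≤ orbitSpan A D u (r + 1 + s) := by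
        refine Submodule.span_le.2 ?_
        rintro _ ⟨j, hj, rfl⟩
        have hj : j < s := hj
        refine orbitSpan_mono D u (show r + 1 + j + 1 ≤ r + 1 + s by lia)
          (mem_orbitSpan_succ.2 ⟨a, _, lead_iter j, by dsimp only; abel⟩)
      have hb : b * a = 0 := indep (r + 1 + s) _ (by
        have h₁ := sub_mem (orbitSpan_mono D u (show r + 1 ≤ r + 1 + s by lia) hwr) (hle hf)
        rw [add_sub_cancel_right] at h₁
        have h₂ := sub_mem h₁ (Submodule.smul_mem _ b (lead_iter s))
        rwa [smul_sub, sub_sub_cancel, ← mul_smul] at h₂)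
      rw [(mul_eq_zero.1 hb).resolve_right ha, zero_smul, zero_add] at hwr ⊢
      exact ih f hf hwr
  rcases hDv with h0 | h
  · refine ha (indep (r + 1) a ?_)
    have := lead_iter 0
    rwa [Function.iterate_zero_apply, h0, zero_sub, neg_mem_iff] at this
  · obtain ⟨s, hs⟩ := mem_iSup_orbitSpan.1 h
    exact hv0 (small s v hs hvr')

end Torsion

section Weyl

open Polynomial

theorem mul_aeval_eq_of_commutator {K A : Type*} [CommRing K] [Ring A] [Algebra K A] {x D : A}
    (h : D * x = x * D + 1) (g : K[X]) :
    D * aeval x g = aeval x g * D + aeval x (derivative g) := by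
  induction g using Polynomial.induction_on with
  | C a => simp [Algebra.commutes]
  | add p q hp hq => simp only [map_add, mul_add, add_mul, hp, hq]; abel
  | monomial n a ih =>
    have e : (C a * X ^ (n + 1) : K[X]) = C a * X ^ n * X := by rw [pow_succ, mul_assoc]
    rw [e, derivative_mul, derivative_X, mul_one, map_add]
    generalize C a * X ^ n = q at ih
    rw [map_mul, map_mul, aeval_X, ← mul_assoc, ih, add_mul, mul_assoc, h, mul_add, mul_one,
      mul_assoc]
    abel

variable {K V : Type*} [Field K] [AddCommGroup V] [Module K V] {x D : Module.End K V}

theorem apply_aeval_of_commutator (h : D * x = x * D + 1) (g : K[X]) (w : V) :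
    D (aeval x g w) = aeval x g (D w) + aeval x (derivative g) w :=
  LinearMap.congr_fun (mul_aeval_eq_of_commutator h g) w

theorem eq_zero_of_apply_eq_smul_of_commutator [CharZero K] (h : D * x = x * D + 1) {μ : K} {w : V}
    (hw : D w = μ • w) {f : K[X]} (hf : f ≠ 0) (hfw : aeval x f w = 0) : w = 0 := by
  induction hn : f.natDegree generalizing f with
  | zero =>
    obtain ⟨a, rfl⟩ := natDegree_eq_zero.1 hn
    rw [aeval_C, Module.algebraMap_end_apply] at hfw
    exact (smul_eq_zero.1 hfw).resolve_left fun ha => hf (by rw [ha, C_0])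
  | succ n ih =>
    refine ih (f := derivative f) (fun h0 => ?_) ?_ (by rw [natDegree_derivative, hn]; rfl)
    · have := derivative_eq_zero.1 h0
      lia
    · have := apply_aeval_of_commutator h f w
      rwa [hfw, hw, map_smul, hfw, map_zero, smul_zero, zero_add, eq_comm] at this

theorem eq_zero_of_aeval_of_commutator [IsAlgClosed K] [CharZero K] (h : D * x = x * D + 1) {w : V}
    {f g : K[X]} (hf : f ≠ 0) (hfw : aeval x f w = 0) (hg : g ≠ 0) (hgw : aeval D g w = 0) :
    w = 0 := by
  have hmul : ∀ (p q : K[X]) (m : V), aeval x q m = 0 → aeval x (p * q) m = 0 := fun p q m hm => by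
    rw [map_mul, Module.End.mul_apply, hm, map_zero]
  let T : Submodule K V :=
    { carrier := {m | ∃ f : K[X], f ≠ 0 ∧ aeval x f m = 0}
      zero_mem' := ⟨1, one_ne_zero, map_zero _⟩
      add_mem' := by
        rintro a b ⟨p, hp, hpa⟩ ⟨q, hq, hqb⟩
        refine ⟨p * q, mul_ne_zero hp hq, ?_⟩
        rw [map_add, hmul p q b hqb, mul_comm, hmul q p a hpa, add_zero]
      smul_mem' := by
        rintro k a ⟨p, hp, hpa⟩
        exact ⟨p, hp, by rw [map_smul, hpa, smul_zero]⟩ }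
  refine eq_zero_of_aeval_apply_eq_zero D T ?_
    (fun μ m ⟨p, hp, hpm⟩ hm => eq_zero_of_apply_eq_smul_of_commutator h hm hp hpm) hg ⟨f, hf, hfw⟩
    hgw
  rintro m ⟨p, hp, hpm⟩
  refine ⟨p * p, mul_ne_zero hp hp, ?_⟩
  have := apply_aeval_of_commutator h (p * p) m
  rwa [hmul p p m hpm, map_zero, derivative_mul, map_add, LinearMap.add_apply, hmul _ p m hpm,
    mul_comm p (derivative p), hmul _ p m hpm, add_zero, add_zero, eq_comm] at this

/-- The `S`-submodules of `V` are the `K`-subspaces that are stable under `x` and `D`. -/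
structure IsGeneratedByPair (S : Type*) [Ring S] [Module S V] (x D : Module.End K V) : Prop where
  smul_mem (P : Submodule S V) (k : K) {m : V} (hm : m ∈ P) : k • m ∈ P
  fst_mem (P : Submodule S V) {m : V} (hm : m ∈ P) : x m ∈ P
  snd_mem (P : Submodule S V) {m : V} (hm : m ∈ P) : D m ∈ P
  smul_mem_of_stable (W : Submodule K V) (hx : ∀ m ∈ W, x m ∈ W) (hD : ∀ m ∈ W, D m ∈ W) (s : S)
    {m : V} (hm : m ∈ W) : s • m ∈ W

namespace IsGeneratedByPair

variable {S : Type*} [Ring S] [Module S V]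

theorem rotate (hS : IsGeneratedByPair S x D) : IsGeneratedByPair S D (-x) where
  smul_mem := hS.smul_mem
  fst_mem := hS.snd_mem
  snd_mem P _ hm := neg_mem (hS.fst_mem P hm)
  smul_mem_of_stable W hD hx s _ hm :=
    hS.smul_mem_of_stable W (fun m hm => neg_mem_iff.1 (hx m hm)) hD s hm

theorem aeval_mem (hS : IsGeneratedByPair S x D) (P : Submodule S V) (g : K[X]) {m : V}
    (hm : m ∈ P) : aeval x g m ∈ P := by
  rw [aeval_endomorphism]
  refine sum_mem fun i hi => hS.smul_mem P _ ?_
  clear hi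
  induction i with
  | zero => exact hm
  | succ i ih =>
    rw [pow_succ', Module.End.mul_apply]
    exact hS.fst_mem P ih

/-- An `S`-submodule as a module over the polynomials in `x`. -/
def toPolynomial (hS : IsGeneratedByPair S x D) [Module K[X] V]
    (hA : ∀ (g : K[X]) (m : V), g • m = aeval x g m) (P : Submodule S V) : Submodule K[X] V :=
  { P with smul_mem' := fun g m hm => by rw [hA]; exact hS.aeval_mem P g hm }

theorem mem_toPolynomial (hS : IsGeneratedByPair S x D) [Module K[X] V]
    (hA : ∀ (g : K[X]) (m : V), g • m = aeval x g m) {P : Submodule S V} {m : V} :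
    m ∈ hS.toPolynomial hA P ↔ m ∈ P := Iff.rfl

theorem span_singleton_le (hS : IsGeneratedByPair S x D) [Module K[X] V]
    (hA : ∀ (g : K[X]) (m : V), g • m = aeval x g m)
    (hD : IsSkewDerivation (fun g : K[X] => derivative g) D.toAddMonoidHom) (u : V) :
    hS.toPolynomial hA (Submodule.span S {u}) ≤ ⨆ n, orbitSpan K[X] D.toAddMonoidHom u n := by
  intro m hm
  obtain ⟨s, rfl⟩ := Submodule.mem_span_singleton.1 hm
  refine hS.smul_mem_of_stable
    { (⨆ n, orbitSpan K[X] D.toAddMonoidHom u n) with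
      smul_mem' := fun k m hm => ?_ } (fun m hm => ?_)
    (fun m hm => hD.map_mem_iSup_orbitSpan hm) s (self_mem_iSup_orbitSpan D.toAddMonoidHom u)
  · have := Submodule.smul_mem (⨆ n, orbitSpan K[X] D.toAddMonoidHom u n) (C k) hm
    rwa [hA, aeval_C] at this
  · have := Submodule.smul_mem (⨆ n, orbitSpan K[X] D.toAddMonoidHom u n) X hm
    rwa [hA, aeval_X] at this

theorem exists_fg_torsionClosure (hS : IsGeneratedByPair S x D) [Module K[X] V]
    (hA : ∀ (g : K[X]) (m : V), g • m = aeval x g m)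
    (hD : IsSkewDerivation (fun g : K[X] => derivative g) D.toAddMonoidHom)
    {N : Submodule S V} (hN0 : N ≠ ⊥) (hN : ∀ P : Submodule S V, P ≠ ⊥ → N ≤ P)
    (P : Submodule S V) (hP : P.FG) :
    ∃ Q : Submodule K[X] V, Q.FG ∧ hS.toPolynomial hA P ≤ torsionClosure Q := by
  obtain ⟨v, hvN, hv0⟩ := N.ne_bot_iff.1 hN0
  have hvmem : ∀ u : V, u ≠ 0 → v ∈ ⨆ n, orbitSpan K[X] D.toAddMonoidHom u n := fun u hu =>
    hS.span_singleton_le hA hD u (hN _ (by simpa using hu) hvN)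
  refine Submodule.fg_induction (motive := fun P _ =>
    ∃ Q : Submodule K[X] V, Q.FG ∧ hS.toPolynomial hA P ≤ torsionClosure Q) (fun u => ?_)
    (fun P₁ P₂ _ _ ⟨Q₁, hQ₁, h₁⟩ ⟨Q₂, hQ₂, h₂⟩ => ⟨Q₁ ⊔ Q₂, hQ₁.sup hQ₂, fun m hm => ?_⟩) P hP
  · by_cases hu : u = 0
    · refine ⟨⊥, Submodule.fg_bot, fun m hm => ?_⟩
      rw [mem_toPolynomial, hu, Submodule.span_zero_singleton, Submodule.mem_bot] at hm
      rw [hm]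
      exact zero_mem _
    · obtain ⟨n, hn⟩ := hD.exists_iterate_mem_torsionClosure hv0 (hvmem u hu)
        ((eq_or_ne (D.toAddMonoidHom v) 0).imp_right fun h => hvmem _ h)
      exact ⟨_, Submodule.fg_span ((Set.finite_Iio n).image _),
        (hS.span_singleton_le hA hD u).trans (iSup_le (hD.orbitSpan_le_torsionClosure hn))⟩
  · obtain ⟨a, ha, b, hb, rfl⟩ := Submodule.mem_sup.1 hm
    exact add_mem (torsionClosure_mono le_sup_left (h₁ ha))
      (torsionClosure_mono le_sup_right (h₂ hb))

theorem exists_rank_function [Module.Finite S V] (hS : IsGeneratedByPair S x D)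
    (h : D * x = x * D + 1) {N : Submodule S V} (hN0 : N ≠ ⊥)
    (hN : ∀ P : Submodule S V, P ≠ ⊥ → N ≤ P) :
    ∃ ρ : Submodule S V → ℕ, Monotone ρ ∧ ∀ P Q, P ≤ Q → ρ Q ≤ ρ P →
      ∀ w ∈ Q, ∃ f : K[X], f ≠ 0 ∧ aeval x f w ∈ P := by
  let _ : Module K[X] V := Module.compHom V (aeval x : K[X] →ₐ[K] Module.End K V).toRingHom
  have hA : ∀ (g : K[X]) (m : V), g • m = aeval x g m := fun _ _ => rfl
  have hD : IsSkewDerivation (fun g : K[X] => derivative g) D.toAddMonoidHom :=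
    fun g m => apply_aeval_of_commutator h g m
  obtain ⟨Q, hQ, hle⟩ := hS.exists_fg_torsionClosure hA hD hN0 hN ⊤ Module.Finite.fg_top
  have : Module.Finite K[X] Q := Module.Finite.iff_fg.2 hQ
  have hfin : Module.rank K[X] V < Cardinal.aleph0 := by
    rw [← rank_top]
    exact (rank_le_of_le_torsionClosure fun m _ => hle (Submodule.mem_top (R := S))).trans_lt
      (Module.rank_lt_aleph0 K[X] Q)
  refine ⟨fun P => Module.finrank K[X] (hS.toPolynomial hA P), fun P Q hPQ => ?_,
    fun P Q hPQ hr w hw => ?_⟩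
  · exact Cardinal.toNat_le_toNat (Submodule.rank_mono hPQ) ((Submodule.rank_le _).trans_lt hfin)
  · exact mem_torsionClosure.1 (le_torsionClosure_of_finrank_le hfin
      (show hS.toPolynomial hA P ≤ hS.toPolynomial hA Q from hPQ) hr hw)

/-- A finitely generated module over the Weyl algebra with a least nonzero submodule is
Artinian. -/
theorem isArtinian_of_commutator [IsAlgClosed K] [CharZero K] [Module.Finite S V]
    (hS : IsGeneratedByPair S x D) (h : D * x = x * D + 1) {N : Submodule S V} (hN0 : N ≠ ⊥)
    (hN : ∀ P : Submodule S V, P ≠ ⊥ → N ≤ P) : IsArtinian S V := by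
  obtain ⟨ρ, hρ, hρ'⟩ := hS.exists_rank_function h hN0 hN
  obtain ⟨σ, hσ, hσ'⟩ := hS.rotate.exists_rank_function (by rw [neg_mul, mul_neg, h]; abel) hN0 hN
  refine StrictMono.wellFoundedLT (f := fun P => ρ P + σ P) fun P Q hPQ => ?_
  by_contra hlt
  have h₁ := hρ hPQ.le
  have h₂ := hσ hPQ.le
  dsimp only at hlt
  refine hPQ.not_ge fun w hw => ?_
  obtain ⟨f, hf, hfw⟩ := hρ' P Q hPQ.le (by lia) w hw
  obtain ⟨g, hg, hgw⟩ := hσ' P Q hPQ.le (by lia) w hw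
  let P' : Submodule K V := { P with smul_mem' := fun k m hm => hS.smul_mem P k hm }
  let x' : Module.End K (V ⧸ P') := P'.mapQ P' x fun m hm => hS.fst_mem P hm
  let D' : Module.End K (V ⧸ P') := P'.mapQ P' D fun m hm => hS.snd_mem P hm
  have h' : D' * x' = x' * D' + 1 := by
    refine Submodule.linearMap_qext _ (LinearMap.ext fun m => ?_)
    exact congrArg P'.mkQ (LinearMap.congr_fun h m)
  have aux : ∀ (y : Module.End K V) (hy : P' ≤ P'.comap y) (f : K[X]), aeval y f w ∈ P →
      aeval (P'.mapQ P' y hy) f (P'.mkQ w) = 0 := fun y hy f hfw => by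
    have e : aeval (P'.mapQ P' y hy) f (P'.mkQ w) = P'.mkQ (aeval y f w) := by
      rw [aeval_endomorphism, aeval_endomorphism, Polynomial.sum_def, Polynomial.sum_def, map_sum]
      exact Finset.sum_congr rfl fun i _ => by
        rw [← Submodule.mapQ_pow, Submodule.mkQ_apply, Submodule.mapQ_apply, map_smul,
          Submodule.mkQ_apply]
    rw [e]
    exact (Submodule.Quotient.mk_eq_zero P').2 hfw
  have := eq_zero_of_aeval_of_commutator h' hf (aux x _ f hfw) hg (aux D _ g hgw)
  exact (Submodule.Quotient.mk_eq_zero P').1 this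

end IsGeneratedByPair

end Weyl

section Annihilated

open Polynomial

theorem exists_sub_aeval_mem {K R : Type*} [Field K] [CharZero K] [CommRing R] [Algebra K R]
    (d : Derivation K R R) {I : Ideal R} (hconst : ∀ c, d c ∈ I → ∃ μ : K, c - algebraMap K R μ ∈ I)
    {x : R} (hx : d x - 1 ∈ I) (n : ℕ) {r : R} (hr : (⇑d)^[n] r ∈ I) :
    ∃ g : K[X], r - aeval x g ∈ I := by
  induction n generalizing r with
  | zero => exact ⟨0, by simpa using hr⟩
  | succ n ih =>
    obtain ⟨g, hg⟩ := ih (r := d r) hr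
    obtain ⟨G, hG⟩ : ∃ G : K[X], derivative G = g := by
      refine ⟨g.sum fun i a => monomial (i + 1) (a / (i + 1)), ?_⟩
      conv_rhs => rw [← g.sum_monomial_eq]
      rw [Polynomial.sum_def, Polynomial.sum_def, map_sum]
      refine Finset.sum_congr rfl fun i _ => ?_
      rw [derivative_monomial, Nat.add_sub_cancel, Nat.cast_add_one,
        div_mul_cancel₀ _ (Nat.cast_add_one_ne_zero i)]
    obtain ⟨μ, hμ⟩ := hconst (r - aeval x G) (by
      have e : d (r - aeval x G) = (d r - aeval x g) - aeval x g * (d x - 1) := by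
        rw [map_sub, Derivation.map_aeval, hG, smul_eq_mul]; ring
      rw [e]
      exact sub_mem hg (Ideal.mul_mem_left I _ hx))
    exact ⟨G + C μ, by rwa [map_add, aeval_C, ← sub_sub]⟩

variable {K R S M : Type*} [Field K] [CommRing R] [Algebra K R] [Ring S] [AddCommGroup M]
  [Module S M] {ι : R →+* S} {θ : S}

/-- The submodule of elements killed by a `δ`-stable ideal of `R`. -/
def annihilated (M : Type*) [AddCommGroup M] [Module S M]
    (hgen : ∀ s, ∃ p : R[X], (p.sum fun i a => ι a * θ ^ i) = s) {δ : R → R}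
    (rel : ∀ a : R, θ * ι a = ι a * θ + ι (δ a)) (I : Ideal R) (hI : ∀ r ∈ I, δ r ∈ I) :
    Submodule S M where
  carrier := {m | ∀ r ∈ I, ι r • m = 0}
  zero_mem' := fun _ _ => smul_zero _
  add_mem' := fun ha hb r hr => by rw [smul_add, ha r hr, hb r hr, add_zero]
  smul_mem' s _ hm := smul_mem_of_generators hgen
    { carrier := {m | ∀ r ∈ I, ι r • m = 0}
      zero_mem' := fun _ _ => smul_zero _
      add_mem' := fun ha hb r hr => by rw [smul_add, ha r hr, hb r hr, add_zero] }
    (fun a m hm r hr => by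
      rw [← mul_smul, ← map_mul, mul_comm, map_mul, mul_smul, hm r hr, smul_zero])
    (fun m hm r hr => by
      rw [← mul_smul, eq_sub_of_add_eq (rel r).symm, sub_smul, mul_smul, hm r hr, smul_zero,
        hm _ (hI r hr), sub_zero]) s hm

theorem submoduleOf_ne_bot {N P : Submodule S M} (hNP : N ≤ P) (hN0 : N ≠ ⊥) :
    N.submoduleOf P ≠ ⊥ := by
  obtain ⟨n, hn, hn0⟩ := N.ne_bot_iff.1 hN0
  exact (Submodule.ne_bot_iff _).2 ⟨⟨n, hNP hn⟩, hn, fun h => hn0 (congrArg Subtype.val h)⟩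

theorem submoduleOf_le_of_ne_bot {N P : Submodule S M}
    (hN : ∀ Q : Submodule S M, Q ≠ ⊥ → N ≤ Q) (Q : Submodule S P) (hQ : Q ≠ ⊥) :
    N.submoduleOf P ≤ Q := by
  have h := hN (Q.map P.subtype)
    fun h => hQ (Submodule.map_injective_of_injective P.subtype_injective
      (h.trans (Submodule.map_bot _).symm))
  rintro ⟨m, hm⟩ hmN
  obtain ⟨q, hq, e⟩ := h hmN
  rwa [← show q = ⟨m, hm⟩ from Subtype.ext e]

/-- Passing from `c` acting as an endomorphism killing `N` to `c` acting as zero. -/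
theorem isArtinian_annihilated_of_isArtinian_annihilated [IsNoetherian S M]
    (hgen : ∀ s, ∃ p : R[X], (p.sum fun i a => ι a * θ ^ i) = s) {δ : R → R}
    (rel : ∀ a : R, θ * ι a = ι a * θ + ι (δ a)) {N : Submodule S M} (hN0 : N ≠ ⊥)
    (hN : ∀ P : Submodule S M, P ≠ ⊥ → N ≤ P) {I J : Ideal R} (hI : ∀ r ∈ I, δ r ∈ I)
    (hJ : ∀ r ∈ J, δ r ∈ J) (hNI : N ≤ annihilated M hgen rel I hI) {c : R} (hc : δ c ∈ I)
    (hcN : ∀ m ∈ N, ι c • m = 0) (hIJ : J ≤ I ⊔ Ideal.span {c})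
    [IsArtinian S (annihilated M hgen rel J hJ)] : IsArtinian S (annihilated M hgen rel I hI) := by
  let A := annihilated M hgen rel I hI
  let φ : Module.End S A := mulEnd hgen rel c fun m => Subtype.ext (m.2 _ hc)
  let f : LinearMap.ker φ →ₗ[S] annihilated M hgen rel J hJ :=
    (A.subtype ∘ₗ (LinearMap.ker φ).subtype).codRestrict _ fun m r hr => by
      obtain ⟨a, ha, b, hb, rfl⟩ := Submodule.mem_sup.1 (hIJ hr)
      obtain ⟨t, rfl⟩ := Ideal.mem_span_singleton'.1 hb
      have : ι c • (m : A).1 = 0 := congrArg Subtype.val (LinearMap.mem_ker.1 m.2)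
      rw [map_add, add_smul, map_mul, mul_smul]
      change ι a • (m : A).1 + ι t • ι c • (m : A).1 = 0
      rw [this, (m : A).2 a ha, smul_zero, add_zero]
  have : IsArtinian S (LinearMap.ker φ) := isArtinian_of_injective f fun a b h => by
    have h' := congrArg Subtype.val h
    exact Subtype.ext (Subtype.ext h')
  exact isArtinian_of_isArtinian_ker (submoduleOf_ne_bot hNI hN0) (submoduleOf_le_of_ne_bot hN) φ
    fun m hm => Subtype.ext (hcN m hm)

theorem isArtinian_of_smul_eq_scalar [IsAlgClosed K] [IsNoetherian S M]
    (hgen : ∀ s, ∃ p : R[X], (p.sum fun i a => ι a * θ ^ i) = s)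
    (hθ : ∀ (r : R) (m : M), θ • ι r • m = ι r • θ • m)
    (hscal : ∀ r, ∃ k : K, ∀ m : M, ι r • m = ι (algebraMap K R k) • m) {N : Submodule S M}
    [IsSimpleModule S N] (hN : ∀ P : Submodule S M, P ≠ ⊥ → N ≤ P) : IsArtinian S M := by
  let _ : Module K M := Module.compHom M (ι.comp (algebraMap K R))
  have hK : ∀ (k : K) (m : M), k • m = ι (algebraMap K R k) • m := fun _ _ => rfl
  have hmem : ∀ W : Submodule K M, (∀ m ∈ W, θ • m ∈ W) → ∀ (s : S) {m : M}, m ∈ W → s • m ∈ W :=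
    fun W hW s m hm => smul_mem_of_generators hgen W.toAddSubmonoid (fun r m hm => by
      obtain ⟨k, hk⟩ := hscal r
      rw [hk, ← hK]
      exact W.smul_mem k hm) hW s hm
  have hN0 : N ≠ ⊥ := (Submodule.nontrivial_iff_ne_bot).1 (IsSimpleModule.nontrivial S N)
  obtain ⟨v, hvN, hv0⟩ := N.ne_bot_iff.1 hN0
  have hv : ∀ m : M, m ≠ 0 → ∃ s : S, s • m = v := fun m hm =>
    Submodule.mem_span_singleton.1 (hN _ (by simpa using hm) hvN)
  let D : Module.End K M :=
    { toFun := fun m => θ • m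
      map_add' := smul_add θ
      map_smul' := fun k m => hθ _ m }
  obtain ⟨μ, w, hw, hw0⟩ : ∃ μ : K, ∃ w : M, θ • w = μ • w ∧ w ≠ 0 := by
    by_contra! H
    obtain ⟨s, hs⟩ := hv (θ • v) fun h => hv0 (H 0 v (by rw [h, zero_smul]))
    let W : Submodule K M := LinearMap.range
      ((LinearMap.applyₗ (D v)).comp (aeval D : K[X] →ₐ[K] Module.End K M).toLinearMap)
    have hsW : s • D v ∈ W := hmem W (by
      rintro _ ⟨g, rfl⟩
      refine ⟨X * g, ?_⟩
      simp [D]) s ⟨1, by simp⟩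
    obtain ⟨g, hg⟩ := hsW
    refine hv0 (eq_zero_of_aeval_apply_eq_zero D ⊤ (fun _ _ => trivial) (fun μ w _ => H μ w)
      (g := g * X - 1) (fun h0 => ?_) trivial ?_)
    · simpa using congrArg (eval 0) h0
    · have hg' : aeval D g (D v) = v := hg.trans hs
      rw [map_sub, map_mul, aeval_X, map_one, LinearMap.sub_apply, Module.End.mul_apply, hg',
        Module.End.one_apply, sub_self]
  let φ : Module.End S M := endOfGenerators hgen
    (DistribSMul.toAddMonoidHom M θ - DistribSMul.toAddMonoidHom M (ι (algebraMap K R μ)))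
    (fun r m => by
      simp only [AddMonoidHom.sub_apply, DistribSMul.toAddMonoidHom_apply, smul_sub, hθ,
        ← mul_smul, ← map_mul, mul_comm])
    (fun m => by
      simp only [AddMonoidHom.sub_apply, DistribSMul.toAddMonoidHom_apply, smul_sub, hθ])
  have hφ : ∀ m, m ∈ LinearMap.ker φ ↔ θ • m = μ • m := fun m => sub_eq_zero
  have hle : LinearMap.ker φ ≤ N := fun m hm => by
    by_cases hm0 : m = 0
    · exact hm0 ▸ N.zero_mem
    obtain ⟨s, hs⟩ := hv m hm0
    have := hmem (K ∙ m) (fun a ha => by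
      obtain ⟨k, rfl⟩ := Submodule.mem_span_singleton.1 ha
      rw [hK, hθ, (hφ m).1 hm, ← hK]
      exact Submodule.smul_mem _ _ (Submodule.smul_mem _ _ (Submodule.mem_span_singleton_self m)))
      s (Submodule.mem_span_singleton_self m)
    obtain ⟨k, hk⟩ := Submodule.mem_span_singleton.1 (hs ▸ this)
    have hk0 : k ≠ 0 := fun h => hv0 (by rw [← hk, h, zero_smul])
    rw [← inv_smul_smul₀ hk0 m, hk]
    exact N.smul_mem _ hvN
  have : IsArtinian S (LinearMap.ker φ) := isArtinian_of_le hle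
  exact isArtinian_of_isArtinian_ker hN0 hN φ fun m hm => hN (LinearMap.ker φ)
    ((Submodule.ne_bot_iff _).2 ⟨w, (hφ w).2 hw, hw0⟩) hm

theorem isArtinian_of_smul_eq_aeval [IsAlgClosed K] [CharZero K] [Module.Finite S M]
    (hgen : ∀ s, ∃ p : R[X], (p.sum fun i a => ι a * θ ^ i) = s) (d : Derivation K R R)
    (rel : ∀ a : R, θ * ι a = ι a * θ + ι (d a)) {x : R} (hx : ∀ m : M, ι (d x) • m = m)
    (hpoly : ∀ r, ∃ g : K[X], ∀ m : M, ι r • m = ι (aeval x g) • m) {N : Submodule S M}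
    (hN0 : N ≠ ⊥) (hN : ∀ P : Submodule S M, P ≠ ⊥ → N ≤ P) : IsArtinian S M := by
  let _ : Module R M := Module.compHom M ι
  let _ : Module K M := Module.compHom M (algebraMap K R)
  have : IsScalarTower K R M := .of_algebraMap_smul fun _ _ => rfl
  have hι : ∀ (r : R) (m : M), r • m = ι r • m := fun _ _ => rfl
  have hK : ∀ (k : K) (m : M), k • m = ι (algebraMap K R k) • m := fun _ _ => rfl
  let D : Module.End K M :=
    { toFun := fun m => θ • m
      map_add' := smul_add θ
      map_smul' := fun k m => by
        rw [RingHom.id_apply, hK, hK, ← mul_smul, rel, d.map_algebraMap, map_zero, add_zero,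
          mul_smul] }
  have hS : IsGeneratedByPair S (Algebra.lsmul K K M x) D :=
    { smul_mem := fun P k m hm => P.smul_mem _ hm
      fst_mem := fun P m hm => P.smul_mem _ hm
      snd_mem := fun P m hm => P.smul_mem _ hm
      smul_mem_of_stable := fun W hxW hD s m hm =>
        smul_mem_of_generators hgen W.toAddSubmonoid (fun r m hm => by
          obtain ⟨g, hg⟩ := hpoly r
          change ι r • m ∈ W
          have e : ι r • m = aeval (Algebra.lsmul K K M x) g m := by
            rw [hg, aeval_algHom_apply]
            rfl
          rw [e, aeval_endomorphism]
          exact sum_mem fun i _ => W.smul_mem _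
            (Module.End.pow_apply_mem_of_forall_mem _ hxW _ hm)) hD s hm }
  refine hS.isArtinian_of_commutator (LinearMap.ext fun m => ?_) hN0 hN
  change θ • ι x • m = ι x • θ • m + m
  rw [← mul_smul, rel, add_smul, mul_smul, hx]

theorem isArtinian_of_generators [IsAlgClosed K] [CharZero K] [Algebra.FiniteType K R]
    [IsNoetherian S M] (hgen : ∀ s, ∃ p : R[X], (p.sum fun i a => ι a * θ ^ i) = s)
    (d : Derivation K R R) (hln : ∀ a : R, ∃ n : ℕ, (⇑d)^[n] a = 0)
    (rel : ∀ a : R, θ * ι a = ι a * θ + ι (d a)) {N : Submodule S M} [IsSimpleModule S N]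
    (hN : ∀ P : Submodule S M, P ≠ ⊥ → N ≤ P) : IsArtinian S M := by
  have hR : IsNoetherianRing R := Algebra.FiniteType.isNoetherianRing K R
  have hN0 : N ≠ ⊥ := (Submodule.nontrivial_iff_ne_bot).1 (IsSimpleModule.nontrivial S N)
  obtain ⟨I, ⟨hI, hNI, hart⟩, hmax⟩ := set_has_maximal_iff_noetherian.2 hR
    {I : Ideal R | ∃ hI : ∀ r ∈ I, d r ∈ I, N ≤ annihilated M hgen rel I hI ∧
      (IsArtinian S (annihilated M hgen rel I hI) → IsArtinian S M)}
    ⟨⊥, by simp, fun m _ r hr => by rw [(Submodule.mem_bot R).1 hr, map_zero, zero_smul],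
      fun h => by
        have e : annihilated M hgen rel (⊥ : Ideal R) (by simp) = ⊤ :=
          eq_top_iff.2 fun m _ r hr => by rw [(Submodule.mem_bot R).1 hr, map_zero, zero_smul]
        rw [e] at h
        exact isArtinian_of_linearEquiv Submodule.topEquiv⟩
  have hconst : ∀ c, d c ∈ I → ∃ μ : K, c - algebraMap K R μ ∈ I := fun c hc => by
    obtain ⟨μ, hμ⟩ := exists_sub_algebraMap_smul_eq_zero (V := N) hgen d rel c
      fun v => Subtype.ext (hNI v.2 _ hc)
    have hμ' : ∀ m ∈ N, ι (c - algebraMap K R μ) • m = 0 := fun m hm =>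
      congrArg Subtype.val (hμ ⟨m, hm⟩)
    have hc' : d (c - algebraMap K R μ) ∈ I := by rwa [map_sub, d.map_algebraMap, sub_zero]
    refine ⟨μ, ?_⟩
    generalize c - algebraMap K R μ = c at hμ' hc'
    have hJ : ∀ r ∈ I ⊔ Ideal.span {c}, d r ∈ I ⊔ Ideal.span {c} := fun r hr => by
      obtain ⟨a, ha, b, hb, rfl⟩ := Submodule.mem_sup.1 hr
      obtain ⟨t, rfl⟩ := Ideal.mem_span_singleton'.1 hb
      rw [map_add, d.leibniz, smul_eq_mul, smul_eq_mul, ← add_assoc, mul_comm c]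
      exact Submodule.add_mem_sup (add_mem (hI a ha) (Ideal.mul_mem_left I t hc'))
        (Ideal.mul_mem_left _ _ (Ideal.mem_span_singleton_self c))
    have heq := eq_of_le_of_not_lt le_sup_left (hmax (I ⊔ Ideal.span {c}) ⟨hJ, fun m hm r hr => ?_,
      fun h => hart (isArtinian_annihilated_of_isArtinian_annihilated hgen rel hN0 hN hI hJ hNI hc'
        hμ' le_rfl)⟩)
    · rw [heq]
      exact Ideal.mem_sup_right (Ideal.mem_span_singleton_self c)
    · obtain ⟨a, ha, b, hb, rfl⟩ := Submodule.mem_sup.1 hr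
      obtain ⟨t, rfl⟩ := Ideal.mem_span_singleton'.1 hb
      rw [map_add, add_smul, map_mul, mul_smul, hμ' m hm, smul_zero, hNI hm a ha, add_zero]
  refine hart ?_
  have hsmul : ∀ a b, a - b ∈ I → ∀ m : annihilated M hgen rel I hI, ι a • m = ι b • m :=
    fun a b hab m => by
      rw [← sub_eq_zero, ← sub_smul, ← map_sub]
      exact Subtype.ext (m.2 _ hab)
  by_cases hd : ∀ r, d r ∈ I
  · have := ((Submodule.submoduleOfEquivOfLe hNI).isSimpleModule_iff).2 ‹IsSimpleModule S N›
    refine isArtinian_of_smul_eq_scalar (K := K) hgen (fun r m => ?_) (fun r => ?_)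
      (submoduleOf_le_of_ne_bot hN)
    · rw [← mul_smul, rel, add_smul, mul_smul, hsmul (d r) 0 (by rw [sub_zero]; exact hd r),
        map_zero, zero_smul, add_zero]
    · exact (hconst r (hd r)).imp fun μ hμ => hsmul _ _ hμ
  · push Not at hd
    obtain ⟨r, hr⟩ := hd
    obtain ⟨y, hy, hy'⟩ : ∃ y, d y ∉ I ∧ d (d y) ∈ I := by
      by_contra! H
      have : ∀ n, (⇑d)^[n + 1] r ∉ I := fun n => by
        induction n with
        | zero => exact hr
        | succ n ih =>
          rw [Function.iterate_succ_apply'] at ih ⊢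
          rw [Function.iterate_succ_apply']
          exact H _ ih
      obtain ⟨n, hn⟩ := hln r
      refine this n ?_
      rw [Function.iterate_succ_apply', hn, map_zero]
      exact I.zero_mem
    obtain ⟨μ, hμ⟩ := hconst (d y) hy'
    have hμ0 : μ ≠ 0 := fun h => hy (by rwa [h, map_zero, sub_zero] at hμ)
    have hx : d (μ⁻¹ • y) - 1 ∈ I := by
      have e : d (μ⁻¹ • y) - 1 = algebraMap K R μ⁻¹ * (d y - algebraMap K R μ) := by
        rw [mul_sub, ← map_mul, inv_mul_cancel₀ hμ0, map_one, d.map_smul, Algebra.smul_def]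
      rw [e]
      exact Ideal.mul_mem_left I _ hμ
    refine isArtinian_of_smul_eq_aeval (x := μ⁻¹ • y) hgen d rel (fun m => ?_) (fun r => ?_)
      (submoduleOf_ne_bot hNI hN0) (submoduleOf_le_of_ne_bot hN)
    · rw [hsmul _ 1 hx, map_one, one_smul]
    · obtain ⟨n, hn⟩ := hln r
      exact (exists_sub_aeval_mem d hconst hx n (hn ▸ I.zero_mem)).imp fun g hg => hsmul _ _ hg

end Annihilated

theorem diamond_of_locally_nilpotent_derivation
    (K : Type*) [Field K] [IsAlgClosed K] [CharZero K]
    (R : Type*) [CommRing R] [Algebra K R] [Algebra.FiniteType K R]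
    (d : Derivation K R R) (hln : ∀ a : R, ∃ n : ℕ, 0 < n ∧ (⇑d)^[n] a = 0)
    (S : Type*) [Ring S] (ι : R →+* S) (θ : S)
    (hS : IsDiffOpRing (⇑d) ι θ) :
    HasDiamond S := by
  intro M _ _ _ N _ hess
  have hR : IsNoetherianRing R := Algebra.FiniteType.isNoetherianRing K R
  have hS' : IsNoetherianRing S := isNoetherianRing_of_generators hS.basis.2 hS.rel
  refine isArtinian_of_generators hS.basis.2 d (fun a => (hln a).imp fun _ h => h.2) hS.rel
    (N := N) fun P hP => ?_
  have hatom : IsAtom N := isSimpleModule_iff_isAtom.1 ‹_›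
  exact hatom.not_disjoint_iff_le.1 fun h => hP (hess P h.eq_bot)
end

section
/- Let R be a domain over a field K of characteristic 0 and d a locally nilpotent derivation of R such that there exists x ∈ R with d(x) = 1. Then the lattice of d-stable left ideals of R and the lattice of left ideals of the subring of constants R^d are isomorphic, via the mutually inverse maps I ↦ I ∩ R^d (for a d-stable left ideal I of R) and J ↦ RJ (for a left ideal J of R^d). In particular, for every d-stable left ideal I one has I = R(I ∩ R^d), and for every left ideal J of R^d one has R^d ∩ (RJ) = J. -/
/-- `J` is a left ideal of the subring of constants `R^d = {a | d a = 0}`: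
a subset of the constants, closed under `0`, addition, negation, and left
multiplication by constants. -/
def IsConstIdeal {R : Type*} [Ring R] (d : R → R) (J : Set R) : Prop :=
  J ⊆ {a : R | d a = 0} ∧ (0 : R) ∈ J ∧ (∀ a ∈ J, ∀ b ∈ J, a + b ∈ J) ∧
    (∀ a ∈ J, -a ∈ J) ∧ ∀ r : R, d r = 0 → ∀ j ∈ J, r * j ∈ J

section Derivation

variable {R : Type*} [Ring R] {d : R → R}

theorem derivation_zero (hadd : ∀ a b : R, d (a + b) = d a + d b) : d 0 = 0 := by
  simpa using hadd 0 0

theorem derivation_one (hmul : ∀ a b : R, d (a * b) = d a * b + a * d b) : d 1 = 0 := by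
  simpa using hmul 1 1

theorem derivation_neg (hadd : ∀ a b : R, d (a + b) = d a + d b) (a : R) : d (-a) = -d a := by
  have h := hadd (-a) a
  rw [neg_add_cancel, derivation_zero hadd] at h
  exact eq_neg_of_add_eq_zero_left h.symm

theorem derivation_natCast (hadd : ∀ a b : R, d (a + b) = d a + d b)
    (hmul : ∀ a b : R, d (a * b) = d a * b + a * d b) (n : ℕ) : d (n : R) = 0 := by
  induction n with
  | zero => simpa using derivation_zero hadd
  | succ n ih => rw [Nat.cast_succ, hadd, ih, derivation_one hmul, add_zero]

theorem derivation_iterate_zero (hadd : ∀ a b : R, d (a + b) = d a + d b) (k : ℕ) :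
    d^[k] 0 = 0 :=
  Function.iterate_fixed (derivation_zero hadd) k

theorem derivation_iterate_add (hadd : ∀ a b : R, d (a + b) = d a + d b) (k : ℕ) (a b : R) :
    d^[k] (a + b) = d^[k] a + d^[k] b := by
  induction k with
  | zero => rfl
  | succ k ih => simp only [Function.iterate_succ_apply', ih, hadd]

theorem derivation_iterate_eq_zero_of_le (hadd : ∀ a b : R, d (a + b) = d a + d b)
    {a : R} {m n : ℕ} (hmn : m ≤ n) (ha : d^[m] a = 0) : d^[n] a = 0 := by
  obtain ⟨k, rfl⟩ := Nat.exists_eq_add_of_le' hmn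
  rw [Function.iterate_add_apply, ha, derivation_iterate_zero hadd]

theorem derivation_iterate_mul_const (hmul : ∀ a b : R, d (a * b) = d a * b + a * d b)
    (k : ℕ) (a : R) {j : R} (hj : d j = 0) : d^[k] (a * j) = d^[k] a * j := by
  induction k with
  | zero => rfl
  | succ k ih => simp only [Function.iterate_succ_apply', ih, hmul, hj, mul_zero, add_zero]

/-- In characteristic zero, the scaled powers `(-x) ^ k / k!` of an element with `d x = 1`
satisfy `d (c (k + 1)) = -c k`. -/
theorem exists_dividedPowers (K : Type*) [Field K] [CharZero K] [Algebra K R]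
    (hadd : ∀ a b : R, d (a + b) = d a + d b)
    (hmul : ∀ a b : R, d (a * b) = d a * b + a * d b) {x : R} (hx : d x = 1) :
    ∃ c : ℕ → R, c 0 = 1 ∧ ∀ k, d (c (k + 1)) = -c k := by
  have hinv : ∀ n : ℕ, n ≠ 0 → d (algebraMap K R (n : K)⁻¹) = 0 := by
    intro n hn
    have hn' : (n : K) ≠ 0 := Nat.cast_ne_zero.mpr hn
    have h1 : algebraMap K R (n : K)⁻¹ * (n : R) = 1 := by
      rw [← map_natCast (algebraMap K R) n, ← map_mul, inv_mul_cancel₀ hn', map_one]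
    have h2 : (n : R) * algebraMap K R (n : K)⁻¹ = 1 := by
      rw [Nat.cast_comm, h1]
    have h3 := hmul (algebraMap K R (n : K)⁻¹) (n : R)
    rw [h1, derivation_one hmul, derivation_natCast hadd hmul, mul_zero, add_zero] at h3
    rw [← mul_one (d _), ← h2, ← mul_assoc, ← h3, zero_mul]
  have hpow : ∀ k : ℕ, d ((-x) ^ (k + 1)) = -(((k + 1 : ℕ) : R) * (-x) ^ k) := by
    intro k
    induction k with
    | zero => simp [derivation_neg hadd, hx]
    | succ k ih =>
      rw [pow_succ, hmul, ih, derivation_neg hadd, hx, neg_mul, mul_assoc, ← pow_succ]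
      push_cast
      noncomm_ring
  refine ⟨fun k => algebraMap K R (k.factorial : K)⁻¹ * (-x) ^ k, by simp, fun k => ?_⟩
  have hk : ((k + 1 : ℕ) : K) ≠ 0 := Nat.cast_ne_zero.mpr k.succ_ne_zero
  have hfac : algebraMap K R ((k + 1).factorial : K)⁻¹ * ((k + 1 : ℕ) : R)
      = algebraMap K R (k.factorial : K)⁻¹ := by
    rw [← map_natCast (algebraMap K R) (k + 1), ← map_mul, Nat.factorial_succ, Nat.cast_mul,
      mul_inv_rev, mul_assoc, inv_mul_cancel₀ hk, mul_one]
  rw [hmul, hinv _ (Nat.factorial_ne_zero _), hpow, zero_mul, zero_add, mul_neg, ← mul_assoc,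
    hfac]

theorem derivation_sum_dividedPowers (hadd : ∀ a b : R, d (a + b) = d a + d b)
    (hmul : ∀ a b : R, d (a * b) = d a * b + a * d b) {c : ℕ → R} (hc0 : c 0 = 1)
    (hc : ∀ k, d (c (k + 1)) = -c k) (a : R) (n : ℕ) :
    d (∑ k ∈ Finset.range (n + 1), c k * d^[k] a) = c n * d^[n + 1] a := by
  induction n with
  | zero => simp [hc0]
  | succ n ih =>
    rw [Finset.sum_range_succ, hadd, ih, hmul, hc, ← Function.iterate_succ_apply' d]
    noncomm_ring

theorem derivation_sum_dividedPowers_eq_zero (hadd : ∀ a b : R, d (a + b) = d a + d b)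
    (hmul : ∀ a b : R, d (a * b) = d a * b + a * d b) {c : ℕ → R} (hc0 : c 0 = 1)
    (hc : ∀ k, d (c (k + 1)) = -c k) {a : R} {n : ℕ} (ha : d^[n] a = 0) :
    d (∑ k ∈ Finset.range n, c k * d^[k] a) = 0 := by
  cases n with
  | zero => simpa using derivation_zero hadd
  | succ n => rw [derivation_sum_dividedPowers hadd hmul hc0 hc, ha, mul_zero]

theorem span_inter_constants_eq (hadd : ∀ a b : R, d (a + b) = d a + d b)
    (hmul : ∀ a b : R, d (a * b) = d a * b + a * d b)
    (hln : ∀ a : R, ∃ n : ℕ, 0 < n ∧ d^[n] a = 0) {c : ℕ → R} (hc0 : c 0 = 1)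
    (hc : ∀ k, d (c (k + 1)) = -c k) {I : Submodule R R} (hI : ∀ a ∈ I, d a ∈ I) :
    Submodule.span R ((I : Set R) ∩ {a : R | d a = 0}) = I := by
  have hiter : ∀ k : ℕ, ∀ a ∈ I, d^[k] a ∈ I := by
    intro k a ha
    induction k with
    | zero => exact ha
    | succ k ih => rw [Function.iterate_succ_apply']; exact hI _ ih
  refine le_antisymm (Submodule.span_le.mpr Set.inter_subset_left) ?_
  have key : ∀ n : ℕ, ∀ a ∈ I, d^[n] a = 0 →
      a ∈ Submodule.span R ((I : Set R) ∩ {a : R | d a = 0}) := by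
    intro n
    induction n with
    | zero =>
      intro a _ h
      rw [show a = 0 from h]
      exact Submodule.zero_mem _
    | succ n ih =>
      intro a ha h
      have hproj : ∑ k ∈ Finset.range (n + 1), c k * d^[k] a ∈
          Submodule.span R ((I : Set R) ∩ {a : R | d a = 0}) :=
        Submodule.subset_span
          ⟨I.sum_mem fun k _ => I.smul_mem (c k) (hiter k a ha),
            derivation_sum_dividedPowers_eq_zero hadd hmul hc0 hc h⟩
      rw [Finset.sum_range_succ', hc0, one_mul, Function.iterate_zero_apply] at hproj
      refine (Submodule.add_mem_iff_right _ (Submodule.sum_mem _ fun k _ => ?_)).mp hproj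
      refine Submodule.smul_mem _ (c (k + 1)) (ih _ (hiter _ a ha) ?_)
      rw [← Function.iterate_add_apply]
      exact derivation_iterate_eq_zero_of_le hadd (by omega) h
  intro a ha
  obtain ⟨n, -, hn⟩ := hln a
  exact key n a ha hn

theorem constants_inter_span_eq (hadd : ∀ a b : R, d (a + b) = d a + d b)
    (hmul : ∀ a b : R, d (a * b) = d a * b + a * d b)
    (hln : ∀ a : R, ∃ n : ℕ, 0 < n ∧ d^[n] a = 0) {c : ℕ → R} (hc0 : c 0 = 1)
    (hc : ∀ k, d (c (k + 1)) = -c k) {J : Set R} (hJ : IsConstIdeal d J) :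
    {a : R | d a = 0} ∩ ((Submodule.span R J : Submodule R R) : Set R) = J := by
  obtain ⟨hJc, hJ0, hJadd, -, hJmul⟩ := hJ
  refine Set.Subset.antisymm ?_ fun a ha => ⟨hJc ha, Submodule.subset_span ha⟩
  rintro a ⟨ha, haJ⟩
  have key : ∀ r : R, ∃ m : ℕ, ∀ n ≥ m, ∑ k ∈ Finset.range n, c k * d^[k] (r * a) ∈ J := by
    clear ha
    induction haJ using Submodule.span_induction with
    | mem j hj =>
      intro r
      obtain ⟨m, -, hm⟩ := hln r
      refine ⟨m, fun n hn => ?_⟩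
      simp only [derivation_iterate_mul_const hmul _ _ (hJc hj), ← mul_assoc, ← Finset.sum_mul]
      exact hJmul _ (derivation_sum_dividedPowers_eq_zero hadd hmul hc0 hc
        (derivation_iterate_eq_zero_of_le hadd hn hm)) j hj
    | zero =>
      intro r
      exact ⟨0, fun n _ => by simpa [derivation_iterate_zero hadd] using hJ0⟩
    | add a b _ _ iha ihb =>
      intro r
      obtain ⟨m, hm⟩ := iha r
      obtain ⟨m', hm'⟩ := ihb r
      refine ⟨max m m', fun n hn => ?_⟩
      simp only [mul_add, derivation_iterate_add hadd, Finset.sum_add_distrib]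
      exact hJadd _ (hm n (le_of_max_le_left hn)) _ (hm' n (le_of_max_le_right hn))
    | smul s a _ iha =>
      intro r
      simpa only [smul_eq_mul, mul_assoc] using iha (r * s)
  obtain ⟨m, hm⟩ := key 1
  have h := hm (m + 1) m.le_succ
  rw [Finset.sum_range_succ', Finset.sum_eq_zero fun k _ => ?_] at h
  · simpa [hc0] using h
  · rw [one_mul, Function.iterate_succ_apply, show d a = 0 from ha,
      derivation_iterate_zero hadd, mul_zero]

theorem isConstIdeal_inter_constants (hadd : ∀ a b : R, d (a + b) = d a + d b)
    (hmul : ∀ a b : R, d (a * b) = d a * b + a * d b) (I : Submodule R R) :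
    IsConstIdeal d ((I : Set R) ∩ {a : R | d a = 0}) := by
  refine ⟨Set.inter_subset_right, ⟨I.zero_mem, derivation_zero hadd⟩, ?_, ?_, ?_⟩
  · rintro a ⟨ha, ha'⟩ b ⟨hb, hb'⟩
    refine ⟨I.add_mem ha hb, ?_⟩
    simp_all
  · rintro a ⟨ha, ha'⟩
    refine ⟨I.neg_mem ha, ?_⟩
    simp_all [derivation_neg hadd]
  · rintro r hr j ⟨hj, hj'⟩
    refine ⟨I.smul_mem r hj, ?_⟩
    simp_all

theorem derivation_mem_span_of_constants (hadd : ∀ a b : R, d (a + b) = d a + d b)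
    (hmul : ∀ a b : R, d (a * b) = d a * b + a * d b) {J : Set R}
    (hJ : J ⊆ {a : R | d a = 0}) : ∀ a ∈ Submodule.span R J, d a ∈ Submodule.span R J := by
  intro a ha
  induction ha using Submodule.span_induction with
  | mem j hj =>
    rw [show d j = 0 from hJ hj]
    exact Submodule.zero_mem _
  | zero =>
    rw [derivation_zero hadd]
    exact Submodule.zero_mem _
  | add a b _ _ iha ihb =>
    rw [hadd]
    exact Submodule.add_mem _ iha ihb
  | smul r a ha iha =>
    rw [smul_eq_mul, hmul]
    exact Submodule.add_mem _ (Submodule.smul_mem _ (d r) ha) (Submodule.smul_mem _ r iha)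

end Derivation

/-- Lemma: for a domain `R` over a field of characteristic `0` with locally nilpotent
derivation `d` and `x ∈ R` with `d x = 1`, the lattice of `d`-stable left ideals of `R`
is isomorphic to the lattice of left ideals of `R^d`, via the mutually inverse maps
`I ↦ I ∩ R^d` and `J ↦ RJ`.  In particular `I = R(I ∩ R^d)` and `R^d ∩ RJ = J`. -/
theorem lattice_iso_of_locally_nilpotent
    (K : Type*) [Field K] [CharZero K]
    (R : Type*) [Ring R] [IsDomain R] [Algebra K R]
    (d : R → R)
    (hadd : ∀ a b : R, d (a + b) = d a + d b)
    (hmul : ∀ a b : R, d (a * b) = d a * b + a * d b)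
    (hln : ∀ a : R, ∃ n : ℕ, 0 < n ∧ d^[n] a = 0)
    (x : R) (hx : d x = 1) :
    (∃ e : {I : Submodule R R // ∀ a ∈ I, d a ∈ I} ≃o {J : Set R // IsConstIdeal d J},
      (∀ I, (e I).1 = (I.1 : Set R) ∩ {a : R | d a = 0}) ∧
      (∀ J, ((e.symm J).1 : Set R) = (Submodule.span R J.1 : Submodule R R))) ∧
    (∀ I : Submodule R R, (∀ a ∈ I, d a ∈ I) →
      Submodule.span R ((I : Set R) ∩ {a : R | d a = 0}) = I) ∧
    (∀ J : Set R, IsConstIdeal d J →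
      {a : R | d a = 0} ∩ ((Submodule.span R J : Submodule R R) : Set R) = J) := by
  obtain ⟨c, hc0, hc⟩ := exists_dividedPowers K hadd hmul hx
  have hspan : ∀ I : Submodule R R, (∀ a ∈ I, d a ∈ I) →
      Submodule.span R ((I : Set R) ∩ {a : R | d a = 0}) = I :=
    fun I hI => span_inter_constants_eq hadd hmul hln hc0 hc hI
  have hconst : ∀ J : Set R, IsConstIdeal d J →
      {a : R | d a = 0} ∩ ((Submodule.span R J : Submodule R R) : Set R) = J :=
    fun J hJ => constants_inter_span_eq hadd hmul hln hc0 hc hJ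
  refine ⟨⟨⟨⟨fun I => ⟨(I.1 : Set R) ∩ {a : R | d a = 0},
        isConstIdeal_inter_constants hadd hmul I.1⟩,
      fun J => ⟨Submodule.span R J.1, derivation_mem_span_of_constants hadd hmul J.2.1⟩,
      fun I => Subtype.ext (hspan I.1 I.2),
      fun J => Subtype.ext ((Set.inter_comm _ _).trans (hconst J.1 J.2))⟩, ?_⟩,
    fun _ => rfl, fun _ => rfl⟩, hspan, hconst⟩
  rintro ⟨I, hI⟩ ⟨I', hI'⟩
  refine ⟨fun h => ?_, fun h => Set.inter_subset_inter_left _ h⟩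
  change I ≤ I'
  rw [← hspan I hI, ← hspan I' hI']
  exact Submodule.span_mono h
end

section
/- Let R be a Noetherian domain over a field K of characteristic 0 with a locally nilpotent derivation d and an element x ∈ R with d(x) = 1, and set S = R[θ; d]. For any a ∈ R \ R^d, the left S-module S/I with I = S(θ + a)θ is θ-torsionfree: if γ ∈ S/I satisfies θγ = 0, then γ = 0. -/
open Polynomial in
/-- Right multiplication by a coefficient does not raise the degree in `θ`. -/
theorem IsDiffOpRing.exists_pow_mul {R S : Type*} [Ring R] [Ring S] {d : R → R} {ι : R →+* S}
    {θ : S} (hS : IsDiffOpRing d ι θ) (n : ℕ) (a : R) :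
    ∃ p : R[X], p.natDegree ≤ n ∧ θ ^ n * ι a = p.eval₂ ι θ := by
  induction n generalizing a with
  | zero => exact ⟨C a, by simp, by simp⟩
  | succ n ih =>
    obtain ⟨p, hp, hpe⟩ := ih a
    obtain ⟨q, hq, hqe⟩ := ih (d a)
    refine ⟨p * X + q, natDegree_add_le_of_degree_le ?_ (by lia), ?_⟩
    · exact natDegree_mul_le.trans (add_le_add hp natDegree_X_le)
    · rw [eval₂_add, eval₂_mul_X, ← hpe, ← hqe, pow_succ, mul_assoc, hS.rel, mul_add, mul_assoc]

open Polynomial in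
theorem Polynomial.eval₂_C_mul_left {R S : Type*} [Ring R] [Ring S] (ι : R →+* S) (θ : S)
    (c : R) (p : R[X]) : (C c * p).eval₂ ι θ = ι c * p.eval₂ ι θ := by
  induction p using Polynomial.induction_on' with
  | add p q hp hq => rw [mul_add, eval₂_add, eval₂_add, hp, hq, mul_add]
  | monomial n b => rw [C_mul_monomial, eval₂_monomial, eval₂_monomial, map_mul, mul_assoc]

open Polynomial in
theorem IsDiffOpRing.exists_eval₂_mul {R S : Type*} [Ring R] [Ring S] {d : R → R} {ι : R →+* S}
    {θ : S} (hS : IsDiffOpRing d ι θ) (p : R[X]) (a : R) :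
    ∃ q : R[X], q.natDegree ≤ p.natDegree ∧ p.eval₂ ι θ * ι a = q.eval₂ ι θ := by
  choose f hf hfe using fun n => hS.exists_pow_mul n a
  refine ⟨∑ i ∈ p.support, C (p.coeff i) * f i, ?_, ?_⟩
  · refine natDegree_sum_le_of_forall_le _ _ fun i hi => ?_
    exact (natDegree_C_mul_le _ _).trans ((hf i).trans (le_natDegree_of_mem_supp i hi))
  · rw [eval₂_finsetSum, eval₂_eq_sum, Polynomial.sum, Finset.sum_mul]
    refine Finset.sum_congr rfl fun i _ => ?_
    rw [Polynomial.eval₂_C_mul_left, mul_assoc, hfe]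

theorem IsDiffOpRing.eval₂_bijective {R S : Type*} [Ring R] [Ring S] {d : R → R} {ι : R →+* S}
    {θ : S} (hS : IsDiffOpRing d ι θ) :
    Function.Bijective fun p : Polynomial R => p.eval₂ ι θ := by
  simpa only [Polynomial.eval₂_eq_sum] using hS.basis

open Polynomial in
/-- A left multiple of `(θ + a)θ` of degree at most one in `θ` vanishes. -/
theorem IsDiffOpRing.eq_zero_of_mul_eq {R S : Type*} [Ring R] [Ring S] {d : R → R} {ι : R →+* S}
    {θ : S} (hS : IsDiffOpRing d ι θ) {a e f : R} {r : S}
    (h : r * ((θ + ι a) * θ) = ι e * θ + ι f) : e = 0 ∧ f = 0 := by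
  obtain ⟨p, rfl⟩ := hS.eval₂_bijective.2 r
  obtain ⟨q, hq, hqe⟩ := hS.exists_eval₂_mul p a
  have key : p * X * X + q * X = C e * X + C f := by
    apply hS.eval₂_bijective.1
    simp only [eval₂_add, eval₂_mul_X, eval₂_C, ← hqe, ← h]
    noncomm_ring
  have hp : p = 0 := by
    have hc := congrArg (fun u => u.coeff (p.natDegree + 2)) key
    simpa [coeff_X, coeff_C, coeff_eq_zero_of_natDegree_lt (show q.natDegree < p.natDegree + 1 by lia)]
      using hc
  have hq0 : q = 0 := hS.eval₂_bijective.1 (by simp [← hqe, hp])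
  rw [hp, hq0] at key
  have h0 := congrArg (fun u => u.coeff 0) key
  have h1 := congrArg (fun u => u.coeff 1) key
  constructor
  · simpa [coeff_C] using h1.symm
  · simpa using h0.symm

open Polynomial in
/-- Right division by the monic operator `(θ + a)θ`. -/
theorem IsDiffOpRing.exists_eq_mul_add {R S : Type*} [Ring R] [Ring S] {d : R → R} {ι : R →+* S}
    {θ : S} (hS : IsDiffOpRing d ι θ) (a : R) (s : S) :
    ∃ (q : S) (b c : R), s = q * ((θ + ι a) * θ) + (ι b * θ + ι c) := by
  have hpow (n : ℕ) : ∃ (q : S) (b c : R), θ ^ n = q * ((θ + ι a) * θ) + (ι b * θ + ι c) := by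
    induction n with
    | zero => exact ⟨0, 0, 1, by simp⟩
    | succ n ih =>
      obtain ⟨q, b, c, h⟩ := ih
      refine ⟨θ * q + ι b, d b + c - b * a, d c, ?_⟩
      rw [pow_succ', h, mul_add, mul_add, ← mul_assoc θ (ι b), hS.rel, hS.rel]
      simp only [map_add, map_sub, map_mul]
      noncomm_ring
  obtain ⟨p, rfl⟩ := hS.eval₂_bijective.2 s
  dsimp only
  induction p using Polynomial.induction_on' with
  | add p q hp hq =>
    obtain ⟨q₁, b₁, c₁, h₁⟩ := hp
    obtain ⟨q₂, b₂, c₂, h₂⟩ := hq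
    refine ⟨q₁ + q₂, b₁ + b₂, c₁ + c₂, ?_⟩
    rw [eval₂_add, h₁, h₂, map_add, map_add]
    noncomm_ring
  | monomial n r =>
    obtain ⟨q, b, c, h⟩ := hpow n
    refine ⟨ι r * q, r * b, r * c, ?_⟩
    rw [eval₂_monomial, h, map_mul, map_mul]
    noncomm_ring

/-- The top-degree term of the iterated Leibniz rule. -/
theorem iterate_leibniz_top {R : Type*} [Ring R] (d : R →+ R)
    (hmul : ∀ a b : R, d (a * b) = d a * b + a * d b) (n m : ℕ) (b a : R)
    (hb : d^[n + 1] b = 0) (ha : d^[m + 1] a = 0) :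
    d^[n + m] (b * a) = (n + m).choose n • (d^[n] b * d^[m] a) := by
  induction n generalizing m b a with
  | zero =>
    induction m generalizing a with
    | zero => simp
    | succ m ih =>
      have hb' : d b = 0 := hb
      have h := ih (d a) ha
      rw [zero_add] at h
      rw [zero_add, Function.iterate_succ_apply, hmul, hb', zero_mul, zero_add, h]
      simp
  | succ n ihn =>
    induction m generalizing a with
    | zero =>
      have ha' : d a = 0 := ha
      have h := ihn 0 (d b) a hb ha
      rw [add_zero, Function.iterate_succ_apply, hmul, ha', mul_zero, add_zero]
      simpa using h
    | succ m ihm =>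
      have h₁ := ihn (m + 1) (d b) a hb ha
      have h₂ := ihm (d a) ha
      rw [show n + 1 + (m + 1) = n + m + 1 + 1 by lia, Function.iterate_succ_apply, hmul,
        iterate_map_add, Nat.choose_succ_succ, add_smul]
      rw [show n + (m + 1) = n + m + 1 by lia] at h₁
      rw [show n + 1 + m = n + m + 1 by lia] at h₂
      rw [h₁, h₂]
      rfl

theorem exists_iterate_ne_zero {R : Type*} [Zero R] {d : R → R}
    (hln : ∀ a : R, ∃ n : ℕ, 0 < n ∧ d^[n] a = 0) {b : R} (hb : b ≠ 0) :
    ∃ n : ℕ, d^[n] b ≠ 0 ∧ d^[n + 1] b = 0 := by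
  classical
  have h : ∃ n, d^[n] b = 0 := (hln b).imp fun _ h => h.2
  obtain ⟨n, hn⟩ : ∃ n, Nat.find h = n + 1 :=
    Nat.exists_eq_succ_of_ne_zero fun h0 => hb (by simpa [h0] using Nat.find_spec h)
  exact ⟨n, Nat.find_min h (by lia), hn ▸ Nat.find_spec h⟩

/-- For a nonconstant `a`, the only solution of `d² b = d (b a)` is `b = 0`. -/
theorem eq_zero_of_map_map_eq_map_mul {R : Type*} [Ring R] [IsDomain R] [CharZero R] (d : R →+ R)
    (hmul : ∀ a b : R, d (a * b) = d a * b + a * d b)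
    (hln : ∀ a : R, ∃ n : ℕ, 0 < n ∧ d^[n] a = 0) {a b : R} (ha : d a ≠ 0)
    (h : d (d b) = d (b * a)) : b = 0 := by
  by_contra hb
  obtain ⟨n, hn, hn'⟩ := exists_iterate_ne_zero hln hb
  obtain ⟨m, hm, hm'⟩ := exists_iterate_ne_zero hln ha
  have htop := iterate_leibniz_top d hmul n (m + 1) b a hn' hm'
  rw [← add_assoc, Function.iterate_succ_apply, ← h, ← Function.iterate_succ_apply,
    ← Function.iterate_succ_apply, show (n + m).succ.succ = m + 1 + (n + 1) by lia,
    Function.iterate_add_apply, hn', iterate_map_zero, nsmul_eq_mul] at htop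
  refine mul_ne_zero ?_ (mul_ne_zero hn hm) htop.symm
  exact Nat.cast_ne_zero.2 (Nat.choose_pos (by lia)).ne'

/-- For a Noetherian domain `R` over a field of characteristic `0` with locally nilpotent
derivation `d`, `x ∈ R` with `d x = 1`, `S = R[θ; d]` and `a ∈ R \ R^d`, the left
`S`-module `S/I` with `I = S(θ+a)θ` is `θ`-torsionfree. -/
theorem quotient_theta_torsionfree
    (K : Type*) [Field K] [CharZero K]
    (R : Type*) [Ring R] [IsDomain R] [IsNoetherianRing R] [Algebra K R]
    (d : R → R)
    (hadd : ∀ a b : R, d (a + b) = d a + d b)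
    (hmul : ∀ a b : R, d (a * b) = d a * b + a * d b)
    (hln : ∀ a : R, ∃ n : ℕ, 0 < n ∧ d^[n] a = 0)
    (x : R) (hx : d x = 1)
    (S : Type*) [Ring S] (ι : R →+* S) (θ : S) (hS : IsDiffOpRing d ι θ)
    (a : R) (ha : d a ≠ 0) :
    ∀ γ : S ⧸ (Submodule.span S {(θ + ι a) * θ} : Submodule S S),
      θ • γ = 0 → γ = 0 := by
  have : CharZero R := charZero_of_injective_algebraMap (FaithfulSMul.algebraMap_injective K R)
  intro γ
  obtain ⟨s, rfl⟩ := Submodule.Quotient.mk_surjective _ γ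
  obtain ⟨q, b, c, rfl⟩ := hS.exists_eq_mul_add a s
  rw [← Submodule.Quotient.mk_smul, Submodule.Quotient.mk_eq_zero, Submodule.Quotient.mk_eq_zero,
    Submodule.mem_span_singleton, Submodule.mem_span_singleton]
  rintro ⟨r, hr⟩
  have hrem : (r - θ * q - ι b) * ((θ + ι a) * θ) = ι (d b + c - b * a) * θ + ι (d c) := by
    rw [sub_mul, sub_mul, ← smul_eq_mul r, hr, smul_eq_mul, mul_add, mul_add, ← mul_assoc θ (ι b),
      hS.rel, hS.rel]
    simp only [map_add, map_sub, map_mul]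
    noncomm_ring
  obtain ⟨hbc, hc⟩ := hS.eq_zero_of_mul_eq hrem
  have hb : b = 0 := by
    refine eq_zero_of_map_map_eq_map_mul (AddMonoidHom.mk' d hadd) hmul hln ha ?_
    have := hadd (d b) c
    rw [sub_eq_zero.1 hbc, hc, add_zero] at this
    exact this.symm
  have hd : d 0 = 0 := (AddMonoidHom.mk' d hadd).map_zero
  have hc0 : c = 0 := by simpa [hb, hd] using hbc
  exact ⟨q, by simp [hb, hc0]⟩
end

section
/- Let A_1(ℂ) denote the first Weyl algebra over ℂ. The polynomial ring R = A_1(ℂ)[x] satisfies property (⋄): every finitely generated essential extension of a simple left R-module is Artinian. -/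
universe u

open Polynomial

theorem isNoetherianRing_polynomial (R : Type*) [Ring R] [IsNoetherianRing R] :
    IsNoetherianRing R[X] := by
  classical
  refine isNoetherianRing_iff.2 ⟨fun I : Ideal R[X] => ?_⟩
  let D : ℕ → Submodule R R[X] := fun n => degreeLE R n ⊓ I.ofPolynomial
  have mem_D (n : ℕ) (p : R[X]) : p ∈ D n ↔ p.natDegree ≤ n ∧ p ∈ I := by
    simp only [D, Submodule.mem_inf, mem_degreeLE, natDegree_le_iff_degree_le]
    rfl
  let J : ℕ →o Ideal R :=
    { toFun := fun n => (D n).map (lcoeff R n)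
      monotone' := by
        refine monotone_nat_of_le_succ fun n => ?_
        rintro _ ⟨p, hp, rfl⟩
        have hp' := (mem_D n p).1 hp
        refine ⟨X * p, (mem_D _ _).2 ⟨?_, I.mul_mem_left _ hp'.2⟩, ?_⟩
        · exact natDegree_mul_le.trans (by have := natDegree_X_le (R := R); lia)
        · simp [coeff_X_mul] }
  obtain ⟨N, hN⟩ := monotone_stabilizes_iff_noetherian.2 ‹IsNoetherianRing R› J
  have hfg : (D N).FG := by
    have h1 : IsNoetherian R (degreeLE R (N : WithBot ℕ)) :=
      isNoetherian_of_fg_of_noetherian _ ⟨_, (degreeLE_eq_span_X_pow (R := R)).symm⟩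
    exact (isNoetherian_submodule.1 h1) _ inf_le_left
  obtain ⟨s, hs⟩ := hfg
  refine ⟨s, le_antisymm ?_ ?_⟩
  · refine Ideal.span_le.2 fun p hp => ?_
    exact ((mem_D N p).1 (hs ▸ Submodule.subset_span hp)).2
  · have key : ∀ n (p : R[X]), p.natDegree ≤ n → p ∈ I → p ∈ Ideal.span (s : Set R[X]) := by
      have base : ∀ p ∈ D N, p ∈ Ideal.span (s : Set R[X]) := by
        intro p hp
        rw [← hs] at hp
        exact Submodule.span_le_restrictScalars R R[X] _ hp
      intro n
      induction n with
      | zero => exact fun p hp hI => base p ((mem_D _ _).2 ⟨hp.trans (Nat.zero_le _), hI⟩)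
      | succ n ih =>
        intro p hp hI
        rcases le_or_gt (n + 1) N with h | h
        · exact base p ((mem_D _ _).2 ⟨hp.trans h, hI⟩)
        · have h1 : p.coeff (n + 1) ∈ J N := by
            rw [hN (n + 1) h.le]
            exact ⟨p, (mem_D _ _).2 ⟨hp, hI⟩, rfl⟩
          obtain ⟨q, hq, hqp⟩ := h1
          have hq' := (mem_D _ _).1 hq
          have hqp : q.coeff N = p.coeff (n + 1) := hqp
          have h2 : p - X ^ (n + 1 - N) * q ∈ Ideal.span (s : Set R[X]) := by
            refine ih _ ?_ (I.sub_mem hI (I.mul_mem_left _ hq'.2))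
            rw [natDegree_le_iff_coeff_eq_zero]
            intro k hk
            rw [coeff_sub, coeff_X_pow_mul']
            rcases Nat.lt_or_eq_of_le (Nat.succ_le_of_lt hk) with hk | hk
            · rw [coeff_eq_zero_of_natDegree_lt (by lia), if_pos (by lia),
                coeff_eq_zero_of_natDegree_lt (by lia), sub_zero]
            · rw [← hk, if_pos (by lia), show n.succ - (n + 1 - N) = N by lia, hqp, sub_self]
          rw [← sub_add_cancel p (X ^ (n + 1 - N) * q)]
          exact Ideal.add_mem _ h2 (Ideal.mul_mem_left _ _ (base q hq))
    exact fun p hp => key _ p le_rfl hp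

/-- Pseudo-division: modulo the left ideal generated by a nonzero element `a`, every element
has a nonzero multiple in a fixed finite span of powers of `η`. -/
theorem exists_smul_sub_mem_span_pow {P W : Type*} [CommRing P] [IsDomain P] [Ring W]
    [Module P W] [IsScalarTower P W W] (η : W) (δ : P → P)
    (rel : ∀ (c : P) (w : W), η * c • w = c • (η * w) + δ c • w)
    (span_pow : ∀ w : W, w ∈ Submodule.span P (Set.range (η ^ · : ℕ → W)))
    {a : W} (ha : a ≠ 0) :
    ∃ d : ℕ, ∀ w : W, ∃ p : P, p ≠ 0 ∧ ∃ b ∈ Submodule.span W {a}, p • w - b ∈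
      Submodule.span P ((η ^ ·) '' Set.Iio d) := by
  classical
  set F : ℕ → Submodule P W := fun n => Submodule.span P ((η ^ ·) '' Set.Iio n) with hF
  have F_succ (n : ℕ) (w : W) : w ∈ F (n + 1) ↔ ∃ c : P, ∃ z ∈ F n, w = c • η ^ n + z := by
    simp only [hF]
    rw [Set.Iio_add_one_eq_Iic, ← Set.Iio_insert, Set.image_insert_eq, Submodule.mem_span_insert]
  have F_le (n : ℕ) : F n ≤ F (n + 1) := fun w hw => (F_succ n w).2 ⟨0, w, hw, by simp⟩
  have F_mono : Monotone F := monotone_nat_of_le_succ F_le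
  have exists_mem (w : W) : ∃ n, w ∈ F n := by
    induction span_pow w using Submodule.span_induction with
    | mem x hx =>
      obtain ⟨i, rfl⟩ := hx
      exact ⟨i + 1, Submodule.subset_span ⟨i, by simp, rfl⟩⟩
    | zero => exact ⟨0, zero_mem _⟩
    | add x y _ _ hx hy =>
      obtain ⟨m, hm⟩ := hx
      obtain ⟨n, hn⟩ := hy
      exact ⟨max m n, add_mem (F_mono (le_max_left m n) hm) (F_mono (le_max_right m n) hn)⟩
    | smul c x _ hx =>
      obtain ⟨m, hm⟩ := hx
      exact ⟨m, Submodule.smul_mem _ _ hm⟩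
  have pow_mem (n : ℕ) : η ^ n ∈ F (n + 1) := (F_succ n _).2 ⟨1, 0, zero_mem _, by simp⟩
  have mul_mem (n : ℕ) (w : W) (hw : w ∈ F n) : η * w ∈ F (n + 1) := by
    induction hw using Submodule.span_induction with
    | mem x hx =>
      obtain ⟨i, hi, rfl⟩ := hx
      refine Submodule.subset_span ⟨i + 1, ?_, pow_succ' η i⟩
      simpa using hi
    | zero => simp
    | add x y _ _ hx hy => rw [mul_add]; exact add_mem hx hy
    | smul c x hx h =>
      rw [rel]
      exact add_mem (Submodule.smul_mem _ _ h) (Submodule.smul_mem _ _ (F_le n hx))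
  have hex := exists_mem a
  obtain ⟨d, hd, hd'⟩ : ∃ d, a ∈ F (d + 1) ∧ a ∉ F d := by
    have h0 : Nat.find hex ≠ 0 := by
      intro h
      have := Nat.find_spec hex
      rw [h] at this
      exact ha (by simpa [F] using this)
    obtain ⟨d, hd⟩ := Nat.exists_eq_succ_of_ne_zero h0
    refine ⟨d, ?_, Nat.find_min hex (by lia)⟩
    have := Nat.find_spec hex
    rwa [hd] at this
  obtain ⟨c, z, hz, hcz⟩ := (F_succ d a).1 hd
  have hc : c ≠ 0 := by
    rintro rfl
    exact hd' (by simpa [hcz] using hz)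
  have lead (k : ℕ) : η ^ k * a - c • η ^ (d + k) ∈ F (d + k) := by
    induction k with
    | zero => simpa [hcz] using hz
    | succ k ih =>
      have : η ^ (k + 1) * a - c • η ^ (d + (k + 1))
          = η * (η ^ k * a - c • η ^ (d + k)) + δ c • η ^ (d + k) := by
        rw [mul_sub, rel, ← add_assoc d k 1, pow_succ', pow_succ' η (d + k), mul_assoc]
        abel
      rw [this]
      exact add_mem (mul_mem _ _ ih) (Submodule.smul_mem _ _ (pow_mem _))
  have key (k : ℕ) : ∀ w ∈ F (d + k), ∃ p : P, p ≠ 0 ∧ ∃ b ∈ Submodule.span W {a}, p • w - b ∈ F d := by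
    induction k with
    | zero => exact fun w hw => ⟨1, one_ne_zero, 0, zero_mem _, by simpa using hw⟩
    | succ k ih =>
      intro w hw
      obtain ⟨e, y, hy, rfl⟩ := (F_succ (d + k) w).1 hw
      obtain ⟨p, hp, b, hb, h⟩ := ih (c • (e • η ^ (d + k) + y) - e • (η ^ k * a)) (by
        have : c • (e • η ^ (d + k) + y) - e • (η ^ k * a)
            = c • y - e • (η ^ k * a - c • η ^ (d + k)) := by
          rw [smul_add, smul_sub, smul_comm c e]
          abel
        rw [this]
        exact sub_mem (Submodule.smul_mem _ _ hy) (Submodule.smul_mem _ _ (lead k)))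
      refine ⟨p * c, mul_ne_zero hp hc, p • e • (η ^ k * a) + b, add_mem ?_ hb, ?_⟩
      · rw [← smul_mul_assoc, ← smul_mul_assoc]
        exact Submodule.smul_mem _ _ (Submodule.mem_span_singleton_self a)
      · rw [smul_sub] at h
        rwa [mul_smul, ← sub_sub]
  refine ⟨d, fun w => ?_⟩
  obtain ⟨n, hn⟩ := exists_mem w
  exact key n w (F_mono (Nat.le_add_left n d) hn)

/-- If a `W`-module is finitely generated up to `P`-torsion over a domain `P`, the `P`-rank of
`W`-submodules detects inclusions up to torsion. -/
theorem exists_monotone_rank {P W Q : Type*} [CommRing P] [IsDomain P] [Ring W] [AddCommGroup Q]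
    [Module P W] [Module W Q] [Module P Q] [IsScalarTower P W Q] {s : Set Q} (hs : s.Finite)
    (h : ∀ v : Q, ∃ p : P, p ≠ 0 ∧ p • v ∈ Submodule.span P s) :
    ∃ r : Submodule W Q → ℕ, Monotone r ∧
      ∀ L L', L ≤ L' → r L = r L' → ∀ v ∈ L', ∃ p : P, p ≠ 0 ∧ p • v ∈ L := by
  have hfin : Module.rank P Q < Cardinal.aleph0 := by
    rw [← rank_quotient_add_rank_of_isDomain (Submodule.span P s)]
    have : Module.rank P (Q ⧸ Submodule.span P s) = 0 := by
      rw [rank_eq_zero_iff]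
      rintro ⟨v⟩
      obtain ⟨p, hp, hv⟩ := h v
      exact ⟨p, hp, (Submodule.Quotient.mk_eq_zero _).2 hv⟩
    rw [this, zero_add]
    exact (rank_span_le s).trans_lt (Cardinal.lt_aleph0_iff_finite.2 hs)
  have hfin' (L : Submodule P Q) : Module.rank P L < Cardinal.aleph0 :=
    (Submodule.rank_le L).trans_lt hfin
  refine ⟨fun L => Module.finrank P (L.restrictScalars P), fun L L' hL => ?_,
    fun L L' hL hr v hv => ?_⟩
  · exact Cardinal.toNat_le_toNat (Submodule.rank_mono (fun _ h => hL h)) (hfin' _)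
  · have hr' : Module.rank P (L.restrictScalars P) = Module.rank P (L'.restrictScalars P) :=
      (Cardinal.toNat_inj_of_lt_aleph0 (hfin' _) (hfin' _)).1 hr
    let K : Submodule P (L'.restrictScalars P) :=
      (L.restrictScalars P).comap (L'.restrictScalars P).subtype
    have hK : Module.rank P K = Module.rank P (L.restrictScalars P) :=
      LinearEquiv.rank_eq (Submodule.comapSubtypeEquivOfLe (fun _ h => hL h))
    have h1 := rank_quotient_add_rank_of_isDomain K
    rw [hK, hr'] at h1
    have h2 : Module.rank P (L'.restrictScalars P ⧸ K) = 0 := by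
      have h3 : Module.rank P (L'.restrictScalars P ⧸ K) + Module.rank P (L'.restrictScalars P) =
          0 + Module.rank P (L'.restrictScalars P) := by rw [h1, zero_add]
      exact Cardinal.eq_of_add_eq_add_right h3 (hfin' _)
    obtain ⟨p, hp, hpv⟩ := rank_eq_zero_iff.1 h2 (Submodule.Quotient.mk ⟨v, hv⟩)
    exact ⟨p, hp, (Submodule.Quotient.mk_eq_zero K).1 hpv⟩

theorem exists_monotone_rank_quotient_span_singleton {P W : Type*} [CommRing P] [IsDomain P]
    [Ring W] (φ : P →+* W) (η : W) (δ : P → P)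
    (rel : ∀ c : P, η * φ c = φ c * η + φ (δ c))
    (span_pow : ∀ S : AddSubmonoid W, (∀ c, ∀ w ∈ S, φ c * w ∈ S) → (∀ i, η ^ i ∈ S) → S = ⊤)
    {a : W} (ha : a ≠ 0) :
    ∃ r : Submodule W (W ⧸ Submodule.span W {a}) → ℕ, Monotone r ∧
      ∀ L L', L ≤ L' → r L = r L' → ∀ v ∈ L', ∃ p : P, p ≠ 0 ∧ φ p • v ∈ L := by
  let _ : Module P W := Module.compHom W φ
  have : IsScalarTower P W W := ⟨fun c v w => mul_assoc (φ c) v w⟩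
  have : IsScalarTower P W (W ⧸ Submodule.span W {a}) := ⟨fun c v w => by
    obtain ⟨w, rfl⟩ := Submodule.Quotient.mk_surjective _ w
    exact congrArg Submodule.Quotient.mk (mul_assoc (φ c) v w)⟩
  have rel' (c : P) (w : W) : η * c • w = c • (η * w) + δ c • w := by
    change η * (φ c * w) = φ c * (η * w) + φ (δ c) * w
    rw [← mul_assoc, rel, add_mul, mul_assoc]
  have span_pow' (w : W) : w ∈ Submodule.span P (Set.range (η ^ · : ℕ → W)) := by
    have := span_pow (Submodule.span P (Set.range (η ^ · : ℕ → W))).toAddSubmonoid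
      (fun c w hw => Submodule.smul_mem _ c hw) (fun i => Submodule.subset_span ⟨i, rfl⟩)
    exact (this.symm ▸ AddSubmonoid.mem_top w :
      w ∈ (Submodule.span P (Set.range (η ^ · : ℕ → W))).toAddSubmonoid)
  obtain ⟨d, hd⟩ := exists_smul_sub_mem_span_pow η δ rel' span_pow' ha
  let s : Set (W ⧸ Submodule.span W {a}) :=
    Submodule.Quotient.mk '' ((η ^ · : ℕ → W) '' Set.Iio d)
  obtain ⟨r, hr, hr'⟩ := exists_monotone_rank (W := W) (s := s)
    (((Set.finite_Iio d).image _).image _) (fun v => by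
      obtain ⟨w, rfl⟩ := Submodule.Quotient.mk_surjective _ v
      obtain ⟨p, hp, b, hb, h⟩ := hd w
      refine ⟨p, hp, ?_⟩
      have h1 := Submodule.mem_map_of_mem
        (f := ((Submodule.span W {a}).mkQ.restrictScalars P)) h
      rw [Submodule.map_span] at h1
      have h2 : (Submodule.mkQ (Submodule.span W {a})) (p • w - b) =
          p • Submodule.Quotient.mk w := by
        rw [map_sub, Submodule.mkQ_apply _ b, (Submodule.Quotient.mk_eq_zero _).2 hb, sub_zero]
        rfl
      exact h2 ▸ h1)
  exact ⟨r, hr, fun L L' hL h v hv => hr' L L' hL h v hv⟩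

section Weyl

variable {W : Type*} [Ring W] {ι : ℂ[X] →+* W} {θ : W}

theorem commute_const (rel : ∀ a, θ * ι a = ι a * θ + ι (derivative a)) (c : ℂ) :
    Commute (ι (C c)) θ := by
  have := rel (C c)
  rw [derivative_C, map_zero, add_zero] at this
  exact this.symm

/-- The ring homomorphism `ℂ[X] →+* W` extending `ι` on constants and sending `X` to `θ`. -/
noncomputable def evalDeriv (rel : ∀ a, θ * ι a = ι a * θ + ι (derivative a)) : ℂ[X] →+* W :=
  eval₂RingHom' (ι.comp C) θ (commute_const rel)

theorem evalDeriv_C (rel : ∀ a, θ * ι a = ι a * θ + ι (derivative a)) (c : ℂ) :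
    evalDeriv rel (C c) = ι (C c) :=
  eval₂_C _ _

theorem evalDeriv_X (rel : ∀ a, θ * ι a = ι a * θ + ι (derivative a)) :
    evalDeriv rel X = θ :=
  eval₂_X _ _

theorem X_mul_evalDeriv (rel : ∀ a, θ * ι a = ι a * θ + ι (derivative a)) (q : ℂ[X]) :
    ι X * evalDeriv rel q = evalDeriv rel q * ι X + evalDeriv rel (-derivative q) := by
  have hX : ι X * θ = θ * ι X - 1 := by rw [rel]; simp
  induction q using Polynomial.induction_on' with
  | add p q hp hq => simp only [map_add, mul_add, add_mul, neg_add, hp, hq]; abel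
  | monomial n c =>
    induction n with
    | zero =>
      simp only [monomial_zero_left, derivative_C, neg_zero, map_zero, add_zero, evalDeriv_C]
      rw [← map_mul, ← map_mul, mul_comm]
    | succ n ih =>
      have h : monomial (n + 1) c = monomial n c * X := by simp
      rw [h, map_mul, evalDeriv_X, ← mul_assoc, ih, add_mul, mul_assoc, hX, derivative_mul,
        derivative_X, mul_one]
      simp only [map_neg, map_add, map_mul, evalDeriv_X]
      noncomm_ring

/-- `W` is spanned by the elements `ι p * θ ^ i`. -/
def SpannedByPowers (ι : ℂ[X] →+* W) (θ : W) : Prop :=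
  ∀ S : AddSubmonoid W, (∀ c, ∀ w ∈ S, ι c * w ∈ S) → (∀ i, θ ^ i ∈ S) → S = ⊤

theorem SpannedByPowers.evalDeriv (rel : ∀ a, θ * ι a = ι a * θ + ι (derivative a))
    (hs : SpannedByPowers ι θ) : SpannedByPowers (evalDeriv rel) (ι X) := by
  intro S hS hX
  let T : AddSubmonoid W :=
    AddSubmonoid.closure {w | ∃ p i, w = _root_.evalDeriv rel p * ι X ^ i}
  have hTS : T ≤ S := by
    refine (AddSubmonoid.closure_le).2 ?_
    rintro _ ⟨p, i, rfl⟩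
    exact hS _ _ (hX i)
  have hmul (p : ℂ[X]) (w : W) (hw : w ∈ T) : _root_.evalDeriv rel p * w ∈ T := by
    induction hw using AddSubmonoid.closure_induction with
    | mem x hx =>
      obtain ⟨q, i, rfl⟩ := hx
      exact AddSubmonoid.subset_closure ⟨p * q, i, by rw [map_mul, mul_assoc]⟩
    | zero => simp
    | add x y _ _ hx hy => rw [mul_add]; exact T.add_mem hx hy
  have hmulX (w : W) (hw : w ∈ T) : ι X * w ∈ T := by
    induction hw using AddSubmonoid.closure_induction with
    | mem x hx =>
      obtain ⟨q, i, rfl⟩ := hx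
      rw [← mul_assoc, X_mul_evalDeriv, add_mul, mul_assoc, ← pow_succ']
      exact T.add_mem (AddSubmonoid.subset_closure ⟨q, i + 1, rfl⟩)
        (AddSubmonoid.subset_closure ⟨-derivative q, i, rfl⟩)
    | zero => simp
    | add x y _ _ hx hy => rw [mul_add]; exact T.add_mem hx hy
  have hmulι (p : ℂ[X]) : ∀ w ∈ T, ι p * w ∈ T := by
    induction p using Polynomial.induction_on' with
    | add p q hp hq =>
      intro w hw
      rw [map_add, add_mul]
      exact T.add_mem (hp w hw) (hq w hw)
    | monomial n c =>
      intro w hw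
      induction n generalizing w with
      | zero =>
        rw [monomial_zero_left, ← evalDeriv_C rel]
        exact hmul _ _ hw
      | succ n ih =>
        have h : monomial (n + 1) c = monomial n c * X := by simp
        rw [h, map_mul, mul_assoc]
        exact ih _ (hmulX w hw)
  refine top_le_iff.1 (le_trans (hs T hmulι fun i => ?_).ge hTS)
  exact AddSubmonoid.subset_closure ⟨X ^ i, 0, by rw [map_pow, evalDeriv_X, pow_zero, mul_one]⟩

/-- A module element which is torsion modulo `L` for both polynomial subrings lies in `L`. -/
theorem mem_of_torsion (rel : ∀ a, θ * ι a = ι a * θ + ι (derivative a))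
    (hs : SpannedByPowers ι θ) {Q : Type*} [AddCommGroup Q] [Module W Q] {L L' : Submodule W Q}
    (h₁ : ∀ v ∈ L', ∃ p : ℂ[X], p ≠ 0 ∧ ι p • v ∈ L)
    (h₂ : ∀ v ∈ L', ∃ q : ℂ[X], q ≠ 0 ∧ evalDeriv rel q • v ∈ L) : L' ≤ L := by
  intro v hv
  obtain ⟨q, hq, hqv⟩ := h₂ v hv
  choose p hp hpv using fun i : ℕ => h₁ (θ ^ i • v) (L'.smul_mem _ hv)
  set D : ℂ[X] := ∏ i ∈ Finset.range (q.natDegree + 1), p i with hD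
  have hD0 : D ≠ 0 := Finset.prod_ne_zero_iff.2 fun i _ => hp i
  have hDpow (i : ℕ) (hi : i ∈ Finset.range (q.natDegree + 1)) : ι D • θ ^ i • v ∈ L := by
    rw [hD, ← Finset.prod_erase_mul _ _ hi, map_mul, mul_smul]
    exact L.smul_mem _ (hpv i)
  have hDq (s : ℂ[X]) : ι D • evalDeriv rel s • v ∈ L := by
    rw [← EuclideanDomain.mod_add_div s q, mul_comm, map_add, map_mul, add_smul, mul_smul, smul_add]
    refine L.add_mem ?_ (L.smul_mem _ (L.smul_mem _ hqv))
    have hdeg : (s % q).natDegree < q.natDegree + 1 :=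
      Nat.lt_succ_of_le (natDegree_le_natDegree (EuclideanDomain.mod_lt s hq).le)
    rw [as_sum_range_C_mul_X_pow' (s % q) hdeg, map_sum, Finset.sum_smul, Finset.smul_sum]
    refine L.sum_mem fun i hi => ?_
    rw [map_mul, map_pow, evalDeriv_X, evalDeriv_C, mul_smul, ← mul_smul, ← map_mul, mul_comm,
      map_mul, mul_smul]
    exact L.smul_mem _ (hDpow i hi)
  have hDw (w : W) : ι D • w • v ∈ L := by
    let S : AddSubmonoid W :=
      { carrier := {w | ι D • w • v ∈ L}
        add_mem' := fun hx hy => by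
          have h := L.add_mem hx hy
          rwa [← smul_add, ← add_smul] at h
        zero_mem' := by simp }
    have hS : S = ⊤ := by
      refine hs S (fun c w hw => ?_) fun i => ?_
      · change ι D • (ι c * w) • v ∈ L
        rw [mul_smul, ← mul_smul, ← map_mul, mul_comm, map_mul, mul_smul]
        exact L.smul_mem _ hw
      · have := hDq (X ^ i)
        rwa [map_pow, evalDeriv_X] at this
    exact (hS ▸ AddSubmonoid.mem_top w : w ∈ S)
  have key (n : ℕ) : ∀ D : ℂ[X], D ≠ 0 → D.natDegree ≤ n → (∀ w : W, ι D • w • v ∈ L) → v ∈ L := by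
    induction n with
    | zero =>
      intro D hD hn hw
      rw [eq_C_of_natDegree_le_zero hn] at hD hw
      have h := L.smul_mem (ι (C (D.coeff 0)⁻¹)) (hw 1)
      rwa [one_smul, ← mul_smul, ← map_mul, ← C_mul, inv_mul_cancel₀ (by simpa using hD), C_1,
        map_one, one_smul] at h
    | succ n ih =>
      intro D hD hn hw
      rcases Nat.eq_zero_or_pos D.natDegree with h0 | h0
      · exact ih D hD (by lia) hw
      · refine ih (derivative D) ?_ ?_ fun w => ?_
        · intro h
          exact h0.ne' (derivative_eq_zero.1 h)
        · exact (natDegree_derivative_le D).trans (by lia)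
        · have h : ι (derivative D) = θ * ι D - ι D * θ := by rw [rel]; abel
          rw [h, sub_smul, mul_smul, mul_smul]
          refine L.sub_mem (L.smul_mem _ (hw w)) ?_
          have := hw (θ * w)
          rwa [mul_smul] at this
  exact key _ D hD0 le_rfl hDw

theorem isNoetherian_and_isArtinian_quotient_span_singleton
    (rel : ∀ a, θ * ι a = ι a * θ + ι (derivative a))
    (hs : SpannedByPowers ι θ) {a : W} (ha : a ≠ 0) :
    IsNoetherian W (W ⧸ Submodule.span W {a}) ∧ IsArtinian W (W ⧸ Submodule.span W {a}) := by
  obtain ⟨r₁, hr₁, h₁⟩ := exists_monotone_rank_quotient_span_singleton ι θ derivative rel hs ha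
  obtain ⟨r₂, hr₂, h₂⟩ := exists_monotone_rank_quotient_span_singleton (evalDeriv rel) (ι X)
    (fun q => -derivative q) (X_mul_evalDeriv rel) (hs.evalDeriv rel) ha
  have hmono : StrictMono fun L => r₁ L + r₂ L := by
    intro L L' hL
    have h1 := hr₁ hL.le
    have h2 := hr₂ hL.le
    refine lt_of_le_of_ne (add_le_add h1 h2) fun h => hL.not_ge ?_
    have h : r₁ L + r₂ L = r₁ L' + r₂ L' := h
    exact mem_of_torsion rel hs (h₁ L L' hL.le (by lia)) (h₂ L L' hL.le (by lia))
  have hanti : StrictAnti fun L => (r₁ ⊤ + r₂ ⊤) - (r₁ L + r₂ L) := by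
    intro L L' hL
    have h1 : r₁ L + r₂ L < r₁ L' + r₂ L' := hmono hL
    have h2 := hr₁ (le_top : L' ≤ ⊤)
    have h3 := hr₂ (le_top : L' ≤ ⊤)
    change r₁ ⊤ + r₂ ⊤ - (r₁ L' + r₂ L') < r₁ ⊤ + r₂ ⊤ - (r₁ L + r₂ L)
    lia
  exact ⟨isNoetherian_iff'.2 hanti.wellFoundedGT, hmono.wellFoundedLT⟩

theorem isNoetherianRing_of_spannedByPowers (rel : ∀ a, θ * ι a = ι a * θ + ι (derivative a))
    (hs : SpannedByPowers ι θ) : IsNoetherianRing W := by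
  refine isNoetherianRing_iff.2 ⟨fun I : Submodule W W => ?_⟩
  by_cases hI : I = ⊥
  · exact hI ▸ Submodule.fg_bot
  · obtain ⟨a, haI, ha⟩ := (Submodule.ne_bot_iff I).1 hI
    have := (isNoetherian_and_isArtinian_quotient_span_singleton rel hs ha).1
    refine Submodule.fg_of_fg_map_of_fg_inf_ker (Submodule.span W {a}).mkQ
      (IsNoetherian.noetherian _) ?_
    rw [Submodule.ker_mkQ, inf_eq_right.2 ((Submodule.span_singleton_le_iff_mem a I).2 haI)]
    exact ⟨{a}, by simp⟩

theorem commute_const_all (rel : ∀ a, θ * ι a = ι a * θ + ι (derivative a))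
    (hs : SpannedByPowers ι θ) (c : ℂ) (w : W) : Commute (ι (C c)) w := by
  let S : AddSubmonoid W :=
    { carrier := {w | Commute (ι (C c)) w}
      add_mem' := fun hx hy => Commute.add_right hx hy
      zero_mem' := Commute.zero_right _ }
  have hS : S = ⊤ := by
    refine hs S (fun p w hw => Commute.mul_right ?_ hw) fun i => ?_
    · exact (Commute.all (C c) p).map ι
    · exact (commute_const rel c).pow_right i
  exact (hS ▸ AddSubmonoid.mem_top w : w ∈ S)

end Weyl

/-- A finitely generated `R`-module on which the action of `R` is pointwise the action of a
ring `W` and whose nonzero elements are `W`-torsion is Artinian as soon as the proper cyclic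
quotients of `W` are. -/
theorem isArtinian_of_torsion {R W Q : Type*} [Ring R] [Ring W] [AddCommGroup Q] [Module R Q]
    [Module.Finite R Q] (φ : W →+* R) (h : ∀ (r : R) (q : Q), ∃ w, r • q = φ w • q)
    (hW : ∀ w : W, w ≠ 0 → IsArtinian W (W ⧸ Submodule.span W {w}))
    (ht : ∀ q : Q, q ≠ 0 → ∃ w, w ≠ 0 ∧ φ w • q = 0) : IsArtinian R Q := by
  let _ : Module W Q := Module.compHom Q φ
  let _ : Module W R := Module.compHom R φ
  have : IsScalarTower W R Q := ⟨fun w r q => mul_smul (φ w) r q⟩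
  refine isArtinian_of_tower W ?_
  obtain ⟨s, hs⟩ := Module.Finite.fg_top (R := R) (M := Q)
  have hcyc (q : s) : IsArtinian W (Submodule.span W {(q : Q)}) := by
    by_cases hq : (q : Q) = 0
    · rw [hq, Submodule.span_zero_singleton]
      infer_instance
    · obtain ⟨w, hw, hwq⟩ := ht q hq
      have := hW w hw
      let g : (W ⧸ Submodule.span W {w}) →ₗ[W] Q :=
        (Submodule.span W {w}).liftQ (LinearMap.toSpanSingleton W Q q)
          ((Submodule.span_singleton_le_iff_mem _ _).2 hwq)
      have hg : LinearMap.range g = Submodule.span W {(q : Q)} := by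
        rw [Submodule.range_liftQ, LinearMap.range_toSpanSingleton]
      rw [← hg]
      infer_instance
  have htop : (⨆ q : s, Submodule.span W {(q : Q)}) = ⊤ := by
    refine top_le_iff.1 fun x _ => ?_
    have hx : x ∈ Submodule.span R (s : Set Q) := hs ▸ Submodule.mem_top
    induction hx using Submodule.span_induction with
    | mem x hx =>
      exact Submodule.mem_iSup_of_mem ⟨x, hx⟩ (Submodule.mem_span_singleton_self x)
    | zero => exact zero_mem _
    | add x y _ _ hx hy => exact add_mem (hx trivial) (hy trivial)
    | smul r x _ hx =>
      obtain ⟨w, hw⟩ := h r x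
      rw [hw]
      exact Submodule.smul_mem _ w (hx trivial)
  have hsup : IsArtinian W ↥(⨆ q : s, Submodule.span W {(q : Q)}) := isArtinian_iSup
  rw [htop] at hsup
  exact isArtinian_of_linearEquiv (Submodule.topEquiv (R := W) (M := Q))

/-- A module is Artinian if some nilpotent endomorphism has Artinian kernel. -/
theorem isArtinian_of_isNilpotent {R M : Type*} [Ring R] [AddCommGroup M] [Module R M]
    (f : Module.End R M) (hf : IsNilpotent f) [IsArtinian R (LinearMap.ker f)] :
    IsArtinian R M := by
  have key (k : ℕ) : IsArtinian R (LinearMap.ker (f ^ k)) := by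
    induction k with
    | zero =>
      rw [pow_zero, Module.End.one_eq_id, LinearMap.ker_id]
      infer_instance
    | succ k ih =>
      have hle : LinearMap.ker f ≤ LinearMap.ker (f ^ (k + 1)) := fun x hx => by
        rw [LinearMap.mem_ker, pow_succ, Module.End.mul_apply, LinearMap.mem_ker.1 hx, map_zero]
      refine isArtinian_of_range_eq_ker (Submodule.inclusion hle)
        (f.restrict (p := LinearMap.ker (f ^ (k + 1))) (q := LinearMap.ker (f ^ k))
          fun x hx => ?_) ?_
      · rwa [LinearMap.mem_ker, ← Module.End.mul_apply, ← pow_succ]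
      · ext x
        simp [Submodule.range_inclusion, LinearMap.ker_restrict]
  obtain ⟨n, hn⟩ := hf
  have := key n
  rw [hn, LinearMap.ker_zero] at this
  exact isArtinian_of_linearEquiv (Submodule.topEquiv (R := R) (M := M))

/-- Multiplication by a central element. -/
def centralSMul {R : Type*} (M : Type*) [Ring R] [AddCommGroup M] [Module R M] (z : R)
    (hz : ∀ r, Commute z r) : Module.End R M where
  toFun m := z • m
  map_add' := smul_add z
  map_smul' r m := by rw [RingHom.id_apply, ← mul_smul, (hz r).eq, mul_smul]

theorem commute_X_sub_C {W : Type*} [Ring W] {w : W} (hw : ∀ v, Commute w v) (r : W[X]) :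
    Commute (X - C w) r := by
  refine Commute.sub_left (commute_X r) ?_
  ext n
  rw [coeff_C_mul, coeff_mul_C, (hw _).eq]

section Essential

variable {W : Type*} [Ring W]

theorem exists_smul_eq_C_smul {M : Type*} [AddCommGroup M] [Module W[X] M] {w : W} {m : M}
    (hm : (X : W[X]) • m = (C w : W[X]) • m) (r : W[X]) :
    ∃ v : W, r • m = (C v : W[X]) • m := by
  induction r using Polynomial.induction_on' with
  | add p q hp hq =>
    obtain ⟨v, hv⟩ := hp
    obtain ⟨v', hv'⟩ := hq
    exact ⟨v + v', by rw [add_smul, hv, hv', C_add, add_smul]⟩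
  | monomial n a =>
    induction n generalizing a with
    | zero => exact ⟨a, by simp⟩
    | succ n ih =>
      obtain ⟨v, hv⟩ := ih (a * w)
      refine ⟨v, ?_⟩
      have h : monomial (n + 1) a = monomial n a * X := by simp
      rw [h, mul_smul, hm, ← mul_smul, monomial_mul_C, hv]

/-- A finitely generated essential extension of a simple `W[X]`-module on which `X` acts as a
central element of `W` is Artinian, provided the proper cyclic quotients of `W` are. -/
theorem isArtinian_of_essential [IsNoetherianRing W]
    (hW : ∀ w : W, w ≠ 0 → IsArtinian W (W ⧸ Submodule.span W {w}))
    {M : Type*} [AddCommGroup M] [Module W[X] M] [Module.Finite W[X] M] (N : Submodule W[X] M)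
    [IsSimpleModule W[X] N] (hN : ∀ N' : Submodule W[X] M, N ⊓ N' = ⊥ → N' = ⊥)
    {w : W} (hw : ∀ v, Commute w v) (hX : ∀ n ∈ N, (X : W[X]) • n = C w • n) :
    IsArtinian W[X] M := by
  have := isNoetherianRing_polynomial W
  let f := centralSMul M (X - C w) (commute_X_sub_C hw)
  have hker (m : M) : m ∈ LinearMap.ker f ↔ (X : W[X]) • m = C w • m := by
    rw [LinearMap.mem_ker, ← sub_eq_zero (a := (X : W[X]) • m), ← sub_smul]
    rfl
  have hNf : N ≤ LinearMap.ker f := fun n hn => (hker n).2 (hX n hn)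
  have hnil : IsNilpotent f := by
    obtain ⟨n, hn⟩ := Filter.eventually_atTop.1 f.eventually_disjoint_ker_pow_range_pow
    refine ⟨n + 1, LinearMap.range_eq_bot.1 (hN _ ?_)⟩
    refine ((hn (n + 1) (Nat.le_succ n)).mono_left ?_).eq_bot
    intro x hx
    rw [LinearMap.mem_ker, pow_succ, Module.End.mul_apply, LinearMap.mem_ker.1 (hNf hx), map_zero]
  have hart : IsArtinian W[X] (LinearMap.ker f) := by
    refine (isArtinian_iff_submodule_quotient (N.submoduleOf (LinearMap.ker f))).2 ⟨?_, ?_⟩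
    · exact isArtinian_of_linearEquiv (Submodule.submoduleOfEquivOfLe hNf).symm
    · refine isArtinian_of_torsion (C : W →+* W[X]) ?_ hW ?_
      · rintro r q
        obtain ⟨m, rfl⟩ := Submodule.Quotient.mk_surjective _ q
        obtain ⟨v, hv⟩ := exists_smul_eq_C_smul ((hker m).1 m.2) r
        exact ⟨v, congrArg Submodule.Quotient.mk (Subtype.ext hv)⟩
      · rintro q hq
        obtain ⟨m, rfl⟩ := Submodule.Quotient.mk_surjective _ q
        have hm : (m : M) ≠ 0 := by
          intro h
          apply hq
          rw [(Submodule.coe_eq_zero).1 h, Submodule.Quotient.mk_zero]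
        have h1 : N ⊓ Submodule.span W[X] {(m : M)} ≠ ⊥ := fun h => by
          have := hN _ h
          rw [Submodule.span_singleton_eq_bot] at this
          exact hm this
        obtain ⟨x, ⟨hxN, hxm⟩, hx⟩ := (Submodule.ne_bot_iff _).1 h1
        obtain ⟨r, rfl⟩ := Submodule.mem_span_singleton.1 hxm
        obtain ⟨v, hv⟩ := exists_smul_eq_C_smul ((hker m).1 m.2) r
        refine ⟨v, ?_, ?_⟩
        · rintro rfl
          exact hx (by rw [hv, C_0, zero_smul])
        · rw [← Submodule.Quotient.mk_smul, Submodule.Quotient.mk_eq_zero]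
          change (C v : W[X]) • (m : M) ∈ N
          rwa [← hv]
  exact isArtinian_of_isNilpotent f hnil

end Essential
section Amitsur

/-- If every `t - c` acts bijectively on a nonzero complex vector space, where the action of
`t` is given by a `ℂ[X]`-module structure, then its dimension is uncountable. -/
theorem aleph0_lt_rank_of_bijective {N : Type*} [AddCommGroup N] [Module ℂ N] [Module ℂ[X] N]
    [IsScalarTower ℂ ℂ[X] N] [Nontrivial N]
    (h : ∀ c : ℂ, Function.Bijective fun n : N => (X - C c : ℂ[X]) • n) :
    Cardinal.aleph0 < Module.rank ℂ N := by
  obtain ⟨n₀, hn₀⟩ := exists_ne (0 : N)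
  have tf (d : ℕ) : ∀ p : ℂ[X], p ≠ 0 → p.natDegree ≤ d → ∀ n : N, p • n = 0 → n = 0 := by
    induction d with
    | zero =>
      intro p hp hd n hn
      rw [eq_C_of_natDegree_le_zero hd] at hp hn
      have h1 : (C (p.coeff 0)⁻¹ : ℂ[X]) • (C (p.coeff 0) : ℂ[X]) • n = 0 := by rw [hn, smul_zero]
      rwa [← mul_smul, ← C_mul, inv_mul_cancel₀ (by simpa using hp), C_1, one_smul] at h1
    | succ d ih =>
      intro p hp hd n hn
      by_cases h0 : p.natDegree = 0
      · exact ih p hp (by lia) n hn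
      · obtain ⟨c, hc⟩ := IsAlgClosed.exists_root p fun h => h0 (natDegree_eq_of_degree_eq_some h)
        obtain ⟨q, rfl⟩ := dvd_iff_isRoot.2 hc
        have hq : q ≠ 0 := right_ne_zero_of_mul hp
        rw [natDegree_mul (X_sub_C_ne_zero c) hq, natDegree_X_sub_C] at hd
        refine ih q hq (by lia) n ((h c).1 ?_)
        simpa [mul_smul] using hn
  choose y hy using fun c => (h c).2 n₀
  have hy (c : ℂ) : (X - C c : ℂ[X]) • y c = n₀ := hy c
  have hli : LinearIndependent ℂ y := by
    classical
    rw [linearIndependent_iff']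
    intro s g hg c hc
    set q : ℂ[X] := ∑ i ∈ s, C (g i) * ∏ j ∈ s.erase i, (X - C j) with hq
    have hq0 : q • n₀ = 0 := by
      have h1 : (∏ j ∈ s, (X - C j : ℂ[X])) • ∑ i ∈ s, g i • y i = 0 := by rw [hg, smul_zero]
      rw [← h1, hq, Finset.sum_smul, Finset.smul_sum]
      refine Finset.sum_congr rfl fun i hi => ?_
      rw [← Finset.prod_erase_mul _ _ hi, mul_smul, mul_smul, ← hy i, ← algebraMap_smul ℂ[X] (g i),
        algebraMap_eq]
      simp only [← mul_smul]
      congr 1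
      ring
    have hq1 : q = 0 := by
      by_contra hne
      exact hn₀ (tf _ q hne le_rfl n₀ hq0)
    have h2 : q.eval c = g c * ∏ j ∈ s.erase c, (c - j) := by
      rw [hq, eval_finsetSum, Finset.sum_eq_single_of_mem c hc]
      · simp [eval_prod]
      · intro i hi hic
        rw [eval_mul, eval_prod, Finset.prod_eq_zero (i := c)]
        · simp
        · exact Finset.mem_erase.2 ⟨hic.symm, hc⟩
        · simp
    rw [hq1, eval_zero] at h2
    refine (mul_eq_zero.1 h2.symm).resolve_right (Finset.prod_ne_zero_iff.2 fun j hj => ?_)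
    exact sub_ne_zero.2 (Finset.ne_of_mem_erase hj).symm
  have := hli.cardinal_lift_le_rank
  rw [Cardinal.mk_complex, Cardinal.lift_continuum] at this
  have h3 := Cardinal.aleph0_lt_continuum.trans_le this
  rwa [Cardinal.lift_id'.{0}] at h3

variable {W : Type*} [Ring W] {ι : ℂ[X] →+* W} {θ : W}

/-- On a simple module over `W[X]`, where `W` is the Weyl algebra, `X` acts as a scalar. -/
theorem exists_X_smul_eq (rel : ∀ a, θ * ι a = ι a * θ + ι (derivative a))
    (hs : SpannedByPowers ι θ) (N : Type*) [AddCommGroup N] [Module W[X] N]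
    [IsSimpleModule W[X] N] : ∃ c : ℂ, ∀ n : N, (X : W[X]) • n = C (ι (C c)) • n := by
  have hcomm (c : ℂ) := commute_const_all rel hs c
  by_contra! hno
  let E : ℂ[X] →+* W[X] := mapRingHom (ι.comp C)
  let _ : Module ℂ[X] N := Module.compHom N E
  let _ : Module ℂ N := Module.compHom N (C : ℂ →+* ℂ[X])
  have : IsScalarTower ℂ ℂ[X] N := ⟨fun c p n => by
    rw [smul_eq_C_mul, mul_smul]
    rfl⟩
  have smulX (c : ℂ) (n : N) :
      (X - C c : ℂ[X]) • n = (X - C (ι (C c)) : W[X]) • n := by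
    change E _ • n = _
    simp [E]
  have smulC (c : ℂ) (n : N) : c • n = (C (ι (C c)) : W[X]) • n := by
    change E (C c) • n = _
    simp [E]
  have := IsSimpleModule.nontrivial W[X] N
  have hbig : Cardinal.aleph0 < Module.rank ℂ N := by
    refine aleph0_lt_rank_of_bijective fun c => ?_
    simp only [smulX]
    refine (LinearMap.bijective_or_eq_zero
      (centralSMul N (X - C (ι (C c))) (commute_X_sub_C (hcomm c)))).resolve_right fun h => ?_
    obtain ⟨n, hn⟩ := hno c
    refine hn (sub_eq_zero.1 ?_)
    rw [← sub_smul]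
    exact LinearMap.congr_fun h n
  refine hbig.not_ge ?_
  obtain ⟨n₀, hn₀⟩ := exists_ne (0 : N)
  let v : ℕ × ℕ × ℕ → N := fun i => (X ^ i.1 * C (ι X ^ i.2.1 * θ ^ i.2.2) : W[X]) • n₀
  let V : Submodule ℂ N := Submodule.span ℂ (Set.range v)
  have hV : V = ⊤ := by
    let S : AddSubmonoid W :=
      { carrier := {w | ∀ k i, (X ^ k * C (ι X ^ i * w) : W[X]) • n₀ ∈ V}
        add_mem' := fun hx hy k i => by
          rw [mul_add, C_add, mul_add, add_smul]
          exact V.add_mem (hx k i) (hy k i)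
        zero_mem' := fun k i => by simp }
    have hS : S = ⊤ := by
      refine hs S (fun p w hw => ?_) fun j k i => Submodule.subset_span ⟨(k, i, j), rfl⟩
      induction p using Polynomial.induction_on' with
      | add p q hp hq =>
        rw [map_add, add_mul]
        exact S.add_mem hp hq
      | monomial m c =>
        intro k i
        have h1 : (X ^ k * C (ι X ^ i * (ι (monomial m c) * w)) : W[X]) =
            C (ι (C c)) * (X ^ k * C (ι X ^ (i + m) * w)) := by
          have h2 : ι X ^ i * (ι (monomial m c) * w) = ι (C c) * (ι X ^ (i + m) * w) := by
            rw [← C_mul_X_pow_eq_monomial, map_mul, map_pow, pow_add, mul_assoc (ι (C c)),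
              ← mul_assoc (ι X ^ i), ← (hcomm c _).eq]
            simp only [mul_assoc]
          rw [h2, C_mul, ← mul_assoc, X_pow_mul_C, mul_assoc]
        rw [h1, mul_smul, ← smulC]
        exact V.smul_mem _ (hw k (i + m))
    refine top_le_iff.1 fun n _ => ?_
    obtain ⟨r, rfl⟩ := IsSimpleModule.toSpanSingleton_surjective W[X] hn₀ n
    rw [LinearMap.toSpanSingleton_apply]
    induction r using Polynomial.induction_on' with
    | add p q hp hq =>
      rw [add_smul]
      exact V.add_mem (hp trivial) (hq trivial)
    | monomial k w =>
      have hw : w ∈ S := hS ▸ AddSubmonoid.mem_top w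
      have := hw k 0
      rwa [pow_zero, one_mul, X_pow_mul_C, C_mul_X_pow_eq_monomial] at this
  rw [← rank_top ℂ N, ← hV]
  exact (rank_span_le _).trans (Set.countable_range v).le_aleph0

end Amitsur

theorem IsDiffOpRing.spannedByPowers {W : Type*} [Ring W] {ι : ℂ[X] →+* W} {θ : W}
    (hW : IsDiffOpRing (⇑(derivative (R := ℂ))) ι θ) : SpannedByPowers ι θ := by
  refine fun S hS hθ => top_le_iff.1 fun w _ => ?_
  obtain ⟨p, rfl⟩ := hW.basis.2 w
  exact S.sum_mem fun i _ => hS _ _ (hθ i)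

/-- If `W = A₁(ℂ) = ℂ[x][θ; ∂/∂x]` is the first Weyl algebra over `ℂ`, then the
polynomial ring `R = A₁(ℂ)[x] = W[X]` satisfies property `(⋄)`. -/
theorem weyl_polynomial_hasDiamond
    (W : Type*) [Ring W] (ι : Polynomial ℂ →+* W) (θ : W)
    (hW : IsDiffOpRing (⇑(Polynomial.derivative (R := ℂ))) ι θ) :
    HasDiamond (Polynomial W) := by
  intro M _ _ _ N _ hN
  have hs := hW.spannedByPowers
  have := isNoetherianRing_of_spannedByPowers hW.rel hs
  obtain ⟨c, hc⟩ := exists_X_smul_eq hW.rel hs N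
  exact isArtinian_of_essential
    (fun w hw => (isNoetherian_and_isArtinian_quotient_span_singleton hW.rel hs hw).2) N hN
    (commute_const_all hW.rel hs c) fun n hn => congrArg Subtype.val (hc ⟨n, hn⟩)
end
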